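/- arXiv:2505.22885 — 5 statements merged into one kernel-verified Lean document; each statement's English description precedes it below -/
import Mathlib

section
/- Let m ∈ ℕ and a ∈ ℂ with a not a nonpositive integer (−a ∉ ℕ). Let u be a tempered distribution on ℝ^m × ℝ that is homogeneous of degree a for the dilation action in the last variable, i.e. for every s > 0 and all Schwartz Φ, Ψ on ℝ^m × ℝ with Ψ(p, t) = Φ(p, s⁻¹t) pointwise, u(Ψ) = s^a·u(Φ). Fix k ∈ ℕ with Re(a) + k > 0 and for ψ ∈ 𝓢(ℝ, ℂ) set T_a(ψ) = ((−1)^k / ∏_{j=0}^{k−1}(a+j)) · ∫₀^∞ t^(a+k−1) ψ^{(k)}(t) dt, where ψ^{(k)} is the k-th derivative and t^(a+k−1) = exp((a+k−1)·log t). Then there exist tempered distributions v₊ and v₋ on ℝ^m such that for every φ ∈ 𝓢(ℝ^m, ℂ), every ψ ∈ 𝓢(ℝ, ℂ), and every Schwartz Φ on ℝ^m × ℝ with Φ(p, t) = φ(p)·ψ(t) pointwise, one has u(Φ) = v₊(φ)·T_a(ψ) + v₋(φ)·T_a(ψ̌), where ψ̌(t) = ψ(−t). -/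
open MeasureTheory

/-- The regularized pairing `T_a(ψ) = ((−1)^k / ∏_{j=0}^{k−1}(a+j)) · ∫₀^∞ t^(a+k−1) ψ^{(k)}(t) dt`
with the homogeneous distribution `t_+^{a−1}`. -/
noncomputable def Ta (a : ℂ) (k : ℕ) (ψ : ℝ → ℂ) : ℂ :=
  ((-1 : ℂ) ^ k / ∏ j ∈ Finset.range k, (a + (j : ℂ))) *
    ∫ t in Set.Ioi (0 : ℝ), (t : ℂ) ^ (a + (k : ℂ) - 1) * iteratedDeriv k ψ t

open Filter Topology
open scoped SchwartzMap ContDiff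

section Tensor

variable {E F : Type*} [NormedAddCommGroup E] [NormedSpace ℝ E]
  [NormedAddCommGroup F] [NormedSpace ℝ F]

theorem norm_iteratedFDeriv_comp_continuousLinearMap_le {f : E → ℂ} (hf : ContDiff ℝ ∞ f)
    (L : F →L[ℝ] E) (hL : ‖L‖ ≤ 1) (n : ℕ) (x : F) :
    ‖iteratedFDeriv ℝ n (f ∘ L) x‖ ≤ ‖iteratedFDeriv ℝ n f (L x)‖ := by
  rw [L.iteratedFDeriv_comp_right hf x (mod_cast le_top)]
  refine (ContinuousMultilinearMap.norm_compContinuousLinearMap_le _ _).trans ?_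
  exact mul_le_of_le_one_right (norm_nonneg _)
    (Finset.prod_le_one (fun _ _ => norm_nonneg _) fun _ _ => hL)

namespace SchwartzMap

theorem contDiff_mul_prod (f : 𝓢(E, ℂ)) (g : 𝓢(F, ℂ)) :
    ContDiff ℝ ∞ fun z : E × F => f z.1 * g z.2 :=
  ((f.smooth ⊤).comp contDiff_fst).mul ((g.smooth ⊤).comp contDiff_snd)

theorem norm_pow_mul_iteratedFDeriv_mul_prod_le (f : 𝓢(E, ℂ)) (g : 𝓢(F, ℂ)) (k n : ℕ)
    (x : E × F) :
    ‖x‖ ^ k * ‖iteratedFDeriv ℝ n (fun z : E × F => f z.1 * g z.2) x‖ ≤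
      ∑ i ∈ Finset.range (n + 1), (n.choose i : ℝ) *
        (SchwartzMap.seminorm ℂ k i f * SchwartzMap.seminorm ℂ 0 (n - i) g +
          SchwartzMap.seminorm ℂ 0 i f * SchwartzMap.seminorm ℂ k (n - i) g) := by
  have hx : ‖x‖ ^ k ≤ ‖x.1‖ ^ k + ‖x.2‖ ^ k := by
    rcases max_choice ‖x.1‖ ‖x.2‖ with h | h
    · rw [Prod.norm_def, h]; exact le_add_of_nonneg_right (by positivity)
    · rw [Prod.norm_def, h]; exact le_add_of_nonneg_left (by positivity)
  have h := norm_iteratedFDeriv_mul_le (𝕜 := ℝ) (N := ∞) ((f.smooth ⊤).comp contDiff_fst)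
    ((g.smooth ⊤).comp contDiff_snd) x (n := n) (mod_cast le_top)
  refine (mul_le_mul_of_nonneg_left h (by positivity)).trans ?_
  rw [Finset.mul_sum]
  refine Finset.sum_le_sum fun i _ => ?_
  have h1 : ‖iteratedFDeriv ℝ i (f ∘ Prod.fst) x‖ ≤ ‖iteratedFDeriv ℝ i f x.1‖ :=
    norm_iteratedFDeriv_comp_continuousLinearMap_le (f.smooth ⊤) (ContinuousLinearMap.fst ℝ E F)
      (ContinuousLinearMap.norm_fst_le ..) i x
  have h2 : ‖iteratedFDeriv ℝ (n - i) (g ∘ Prod.snd) x‖ ≤ ‖iteratedFDeriv ℝ (n - i) g x.2‖ :=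
    norm_iteratedFDeriv_comp_continuousLinearMap_le (g.smooth ⊤) (ContinuousLinearMap.snd ℝ E F)
      (ContinuousLinearMap.norm_snd_le ..) (n - i) x
  have f1 := f.le_seminorm ℂ k i x.1
  have f2 := f.norm_iteratedFDeriv_le_seminorm ℂ i x.1
  have g1 := g.le_seminorm ℂ k (n - i) x.2
  have g2 := g.norm_iteratedFDeriv_le_seminorm ℂ (n - i) x.2
  calc ‖x‖ ^ k * (n.choose i * ‖iteratedFDeriv ℝ i (f ∘ Prod.fst) x‖ *
          ‖iteratedFDeriv ℝ (n - i) (g ∘ Prod.snd) x‖)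
      ≤ (‖x.1‖ ^ k + ‖x.2‖ ^ k) * (n.choose i * ‖iteratedFDeriv ℝ i f x.1‖ *
          ‖iteratedFDeriv ℝ (n - i) g x.2‖) := by gcongr
    _ = n.choose i * ((‖x.1‖ ^ k * ‖iteratedFDeriv ℝ i f x.1‖) *
          ‖iteratedFDeriv ℝ (n - i) g x.2‖ + ‖iteratedFDeriv ℝ i f x.1‖ *
          (‖x.2‖ ^ k * ‖iteratedFDeriv ℝ (n - i) g x.2‖)) := by ring
    _ ≤ _ := by gcongr

theorem seminorm_le_sup_Iic (f : 𝓢(E, ℂ)) {j i k n : ℕ} (hj : j ≤ k) (hi : i ≤ n) :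
    SchwartzMap.seminorm ℂ j i f ≤ (Finset.Iic (k, n)).sup (schwartzSeminormFamily ℂ E ℂ) f :=
  Seminorm.le_def.1 (Finset.le_sup (f := schwartzSeminormFamily ℂ E ℂ) (b := (j, i))
    (by simp [hj, hi])) f

/-- The map `f ↦ f ⊗ g` on Schwartz functions. -/
noncomputable def tensorLeftCLM (g : 𝓢(F, ℂ)) : 𝓢(E, ℂ) →L[ℂ] 𝓢(E × F, ℂ) :=
  mkCLM (fun f z => f z.1 * g z.2) (fun _ _ _ => by simp [add_mul])
    (fun _ _ _ => by simp [mul_assoc]) (fun f => contDiff_mul_prod f g) <| by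
  rintro ⟨k, n⟩
  refine ⟨Finset.Iic (k, n), ∑ i ∈ Finset.range (n + 1), (n.choose i : ℝ) *
    (SchwartzMap.seminorm ℂ 0 (n - i) g + SchwartzMap.seminorm ℂ k (n - i) g), by positivity,
    fun f x => (norm_pow_mul_iteratedFDeriv_mul_prod_le f g k n x).trans ?_⟩
  rw [Finset.sum_mul]
  refine Finset.sum_le_sum fun i hi => ?_
  have hi : i ≤ n := Nat.lt_succ_iff.1 (Finset.mem_range.1 hi)
  rw [mul_assoc, add_mul, mul_comm (SchwartzMap.seminorm ℂ k i f),
    mul_comm (SchwartzMap.seminorm ℂ 0 i f)]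
  gcongr
  · exact seminorm_le_sup_Iic f le_rfl hi
  · exact seminorm_le_sup_Iic f (Nat.zero_le _) hi

@[simp]
theorem tensorLeftCLM_apply (f : 𝓢(E, ℂ)) (g : 𝓢(F, ℂ)) (z : E × F) :
    tensorLeftCLM g f z = f z.1 * g z.2 := rfl

/-- The map `g ↦ f ⊗ g` on Schwartz functions. -/
noncomputable def tensorRightCLM (f : 𝓢(E, ℂ)) : 𝓢(F, ℂ) →L[ℂ] 𝓢(E × F, ℂ) :=
  mkCLM (fun g z => f z.1 * g z.2) (fun _ _ _ => by simp [mul_add])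
    (fun _ _ _ => by simp [mul_left_comm]) (fun g => contDiff_mul_prod f g) <| by
  rintro ⟨k, n⟩
  refine ⟨Finset.Iic (k, n), ∑ i ∈ Finset.range (n + 1), (n.choose i : ℝ) *
    (SchwartzMap.seminorm ℂ k i f + SchwartzMap.seminorm ℂ 0 i f), by positivity,
    fun g x => (norm_pow_mul_iteratedFDeriv_mul_prod_le f g k n x).trans ?_⟩
  rw [Finset.sum_mul]
  refine Finset.sum_le_sum fun i hi => ?_
  rw [mul_assoc, add_mul]
  gcongr
  · exact seminorm_le_sup_Iic g (Nat.zero_le _) (Nat.sub_le _ _)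
  · exact seminorm_le_sup_Iic g le_rfl (Nat.sub_le _ _)

@[simp]
theorem tensorRightCLM_apply (f : 𝓢(E, ℂ)) (g : 𝓢(F, ℂ)) (z : E × F) :
    tensorRightCLM f g z = f z.1 * g z.2 := rfl

end SchwartzMap

end Tensor

theorem iteratedDeriv_ofReal_mul_deriv {h : ℝ → ℂ} (hh : ContDiff ℝ ∞ h) (n : ℕ) :
    iteratedDeriv n (fun t : ℝ => (t : ℂ) * deriv h t) =
      fun t : ℝ => (t : ℂ) * iteratedDeriv (n + 1) h t + n * iteratedDeriv n h t := by
  have hd (j : ℕ) (t : ℝ) :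
      HasDerivAt (iteratedDeriv j h) (iteratedDeriv (j + 1) h t) t := by
    rw [iteratedDeriv_succ]
    exact (hh.differentiable_iteratedDeriv j
      (mod_cast WithTop.coe_lt_top _)).differentiableAt.hasDerivAt
  induction n with
  | zero => simp
  | succ n ih =>
    rw [iteratedDeriv_succ, ih]
    ext t
    have h1 := ((Complex.ofRealCLM.hasDerivAt (x := t)).mul (hd (n + 1) t)).add
      ((hd n t).const_mul (n : ℂ))
    refine h1.deriv.trans ?_
    simp
    ring

namespace SchwartzMap

/-- The Euler operator `f ↦ t f'(t)` on Schwartz functions. -/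
noncomputable def eulerCLM : 𝓢(ℝ, ℂ) →L[ℂ] 𝓢(ℝ, ℂ) :=
  smulLeftCLM ℂ (fun t : ℝ => (t : ℂ)) ∘L derivCLM ℂ ℂ

theorem eulerCLM_apply (f : 𝓢(ℝ, ℂ)) (t : ℝ) : eulerCLM f t = t * deriv f t := by
  have h : (fun t : ℝ => (t : ℂ)).HasTemperateGrowth := Complex.ofRealCLM.hasTemperateGrowth
  simp [eulerCLM, smulLeftCLM_apply_apply h]

theorem coe_eulerCLM (f : 𝓢(ℝ, ℂ)) : ⇑(eulerCLM f) = fun t : ℝ => (t : ℂ) * deriv f t :=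
  funext (eulerCLM_apply f)

/-- The dilation `f ↦ f(eʳ t)` on Schwartz functions. -/
noncomputable def dilationCLM (r : ℝ) : 𝓢(ℝ, ℂ) →L[ℂ] 𝓢(ℝ, ℂ) :=
  compCLMOfContinuousLinearEquiv ℂ
    (ContinuousLinearEquiv.unitsEquivAut ℝ (Units.mk0 (Real.exp r) (Real.exp_ne_zero r)))

theorem coe_dilationCLM (r : ℝ) (f : 𝓢(ℝ, ℂ)) :
    ⇑(dilationCLM r f) = fun t => f (Real.exp r * t) := by
  ext t
  simp [dilationCLM, mul_comm]

theorem iteratedDeriv_dilationCLM (r : ℝ) (f : 𝓢(ℝ, ℂ)) (n : ℕ) (t : ℝ) :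
    iteratedDeriv n (dilationCLM r f) t =
      (Real.exp r) ^ n • iteratedDeriv n f (Real.exp r * t) := by
  rw [coe_dilationCLM, iteratedDeriv_comp_const_smul (f.smooth n)]

theorem hasDerivAt_iteratedDeriv (f : 𝓢(ℝ, ℂ)) (n : ℕ) (t : ℝ) :
    HasDerivAt (iteratedDeriv n f) (iteratedDeriv (n + 1) f t) t := by
  rw [iteratedDeriv_succ]
  exact ((f.smooth ⊤).differentiable_iteratedDeriv n
    (mod_cast WithTop.coe_lt_top _)).differentiableAt.hasDerivAt

theorem hasDerivAt_iteratedDeriv_dilationCLM (f : 𝓢(ℝ, ℂ)) (n : ℕ) (t r : ℝ) :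
    HasDerivAt (fun r => iteratedDeriv n (dilationCLM r f) t)
      (iteratedDeriv n (dilationCLM r (eulerCLM f)) t) r := by
  simp only [iteratedDeriv_dilationCLM]
  rw [coe_eulerCLM, iteratedDeriv_ofReal_mul_deriv (f.smooth ⊤)]
  have h := ((Real.hasDerivAt_exp r).fun_pow n).smul
    ((f.hasDerivAt_iteratedDeriv n (Real.exp r * t)).scomp r
      ((Real.hasDerivAt_exp r).mul_const t))
  refine h.congr_deriv ?_
  simp only [Complex.real_smul, Function.comp]
  push_cast
  rcases n with _ | n
  · simp
  · simp; ring

theorem norm_pow_mul_iteratedDeriv_dilationCLM_le (f : 𝓢(ℝ, ℂ)) (k n : ℕ) (t : ℝ) {r : ℝ}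
    (hr : |r| ≤ 1) :
    ‖t‖ ^ k * ‖iteratedDeriv n (dilationCLM r f) t‖ ≤
      Real.exp 1 ^ (k + n) * SchwartzMap.seminorm ℂ k n f := by
  obtain ⟨h1, h2⟩ := abs_le.1 hr
  have ht : ‖t‖ ^ k = Real.exp (-r) ^ k * ‖Real.exp r * t‖ ^ k := by
    rw [norm_mul, ← mul_pow, ← mul_assoc, Real.norm_of_nonneg (Real.exp_pos r).le, ← Real.exp_add]
    simp
  rw [iteratedDeriv_dilationCLM, norm_smul, ht, norm_pow, Real.norm_of_nonneg (Real.exp_pos r).le]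
  calc Real.exp (-r) ^ k * ‖Real.exp r * t‖ ^ k *
        (Real.exp r ^ n * ‖iteratedDeriv n f (Real.exp r * t)‖)
      = (Real.exp (-r) ^ k * Real.exp r ^ n) *
        (‖Real.exp r * t‖ ^ k * ‖iteratedDeriv n f (Real.exp r * t)‖) := by ring
    _ ≤ (Real.exp 1 ^ k * Real.exp 1 ^ n) * SchwartzMap.seminorm ℂ k n f := by
        gcongr
        · linarith
        · exact f.le_seminorm' ℂ k n _
    _ = _ := by rw [pow_add]

theorem norm_sub_zero_le_of_hasDerivAt {f f' : ℝ → ℂ} {C r : ℝ}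
    (hf : ∀ x, HasDerivAt f (f' x) x) (bound : ∀ x, |x| ≤ |r| → ‖f' x‖ ≤ C) :
    ‖f r - f 0‖ ≤ C * |r| := by
  have h := (convex_closedBall (0 : ℝ) |r|).norm_image_sub_le_of_norm_hasDerivWithin_le
    (f := f) (f' := f') (C := C) (x := 0) (y := r) (fun x _ => (hf x).hasDerivWithinAt)
    (fun x hx => bound x (by simpa using hx)) (by simp) (by simp)
  simpa using h

@[simp]
theorem dilationCLM_zero (f : 𝓢(ℝ, ℂ)) : dilationCLM 0 f = f := by
  ext t
  simp [coe_dilationCLM]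

theorem norm_pow_mul_iteratedDeriv_dilationCLM_sub_le (f : 𝓢(ℝ, ℂ)) (k n : ℕ) (t : ℝ) {r : ℝ}
    (hr : |r| ≤ 1) :
    ‖t‖ ^ k * ‖iteratedDeriv n (dilationCLM r f) t - iteratedDeriv n f t -
        r * iteratedDeriv n (eulerCLM f) t‖ ≤
      Real.exp 1 ^ (k + n) * SchwartzMap.seminorm ℂ k n (eulerCLM (eulerCLM f)) * |r| * |r| := by
  set M := Real.exp 1 ^ (k + n) * SchwartzMap.seminorm ℂ k n (eulerCLM (eulerCLM f))
  set c : ℂ := ((‖t‖ ^ k : ℝ) : ℂ)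
  have hc : ‖c‖ = ‖t‖ ^ k := by simp [c]
  have h1 (x : ℝ) (hx : |x| ≤ 1) :
      ‖c * iteratedDeriv n (dilationCLM x (eulerCLM f)) t -
        c * iteratedDeriv n (eulerCLM f) t‖ ≤ M * |x| := by
    have := norm_sub_zero_le_of_hasDerivAt (r := x) (C := M)
      (fun y => ((eulerCLM f).hasDerivAt_iteratedDeriv_dilationCLM n t y).const_mul c)
      (fun y hy => by
        rw [norm_mul, hc]
        exact (eulerCLM (eulerCLM f)).norm_pow_mul_iteratedDeriv_dilationCLM_le k n t
          (hy.trans hx))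
    simpa using this
  have h2 := norm_sub_zero_le_of_hasDerivAt (r := r) (C := M * |r|)
    (fun y => ((f.hasDerivAt_iteratedDeriv_dilationCLM n t y).const_mul c).sub
      ((Complex.ofRealCLM.hasDerivAt (x := y)).mul_const (c * iteratedDeriv n (eulerCLM f) t)))
    (fun y hy => by
      have hM : 0 ≤ M := by positivity
      have := (h1 y (hy.trans hr)).trans (mul_le_mul_of_nonneg_left hy hM)
      simpa using this)
  rw [← hc, ← norm_mul]
  refine le_trans (le_of_eq ?_) h2
  congr 1
  simp
  ring

theorem tendsto_dilationCLM_slope (f : 𝓢(ℝ, ℂ)) :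
    Tendsto (fun r : ℝ => (r : ℂ)⁻¹ • (dilationCLM r f - f)) (𝓝[≠] 0) (𝓝 (eulerCLM f)) := by
  rw [(schwartz_withSeminorms ℂ ℝ ℂ).tendsto_nhds]
  rintro ⟨k, n⟩ ε hε
  set M := Real.exp 1 ^ (k + n) * SchwartzMap.seminorm ℂ k n (eulerCLM (eulerCLM f))
  have hM : 0 ≤ M := by positivity
  have hlim : Tendsto (fun r : ℝ => M * |r|) (𝓝[≠] 0) (𝓝 0) := by
    have : Continuous fun r : ℝ => M * |r| := by fun_prop
    simpa using (this.tendsto 0).mono_left nhdsWithin_le_nhds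
  have h1 : ∀ᶠ r : ℝ in 𝓝[≠] 0, |r| ≤ 1 := by
    have : Continuous fun r : ℝ => |r| := by fun_prop
    exact nhdsWithin_le_nhds
      ((this.tendsto 0).eventually (ge_mem_nhds (by simp)))
  filter_upwards [hlim.eventually (gt_mem_nhds hε), h1, self_mem_nhdsWithin] with r hrε hr hr0
  refine lt_of_le_of_lt ?_ hrε
  refine seminorm_le_bound' ℂ k n _ (by positivity) fun t => ?_
  have hr0 : r ≠ 0 := hr0
  have hr0' : (r : ℂ) ≠ 0 := Complex.ofReal_ne_zero.2 hr0
  have key : iteratedDeriv n ((r : ℂ)⁻¹ • (dilationCLM r f - f) - eulerCLM f) t =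
      (r : ℂ)⁻¹ * (iteratedDeriv n (dilationCLM r f) t - iteratedDeriv n f t -
        r * iteratedDeriv n (eulerCLM f) t) := by
    have s1 := ((dilationCLM r f).smooth n).contDiffAt (x := t)
    have s2 := (f.smooth n).contDiffAt (x := t)
    have s3 := ((eulerCLM f).smooth n).contDiffAt (x := t)
    have e : ⇑((r : ℂ)⁻¹ • (dilationCLM r f - f) - eulerCLM f) =
      (fun t => (r : ℂ)⁻¹ * (dilationCLM r f t - f t)) - ⇑(eulerCLM f) := by ext; simp
    rw [e, iteratedDeriv_sub (contDiffAt_const.mul (s1.sub s2)) s3,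
      iteratedDeriv_const_mul _ (s1.sub s2), iteratedDeriv_fun_sub s1 s2]
    field_simp
  have h := f.norm_pow_mul_iteratedDeriv_dilationCLM_sub_le k n t hr
  rw [key, norm_mul, norm_inv, Complex.norm_real, Real.norm_eq_abs, ← Real.norm_eq_abs t]
  have hpos : 0 < |r| := abs_pos.2 hr0
  rw [mul_left_comm, inv_mul_le_iff₀ hpos]
  exact h.trans_eq (by ring)

end SchwartzMap

/-- Euler's identity for homogeneous tempered distributions on the line. -/
theorem apply_eulerCLM_of_homogeneous (w : 𝓢(ℝ, ℂ) →L[ℂ] ℂ) (a : ℂ)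
    (hw : ∀ (r : ℝ) (f : 𝓢(ℝ, ℂ)), w (SchwartzMap.dilationCLM r f) = Complex.exp (-r * a) * w f)
    (f : 𝓢(ℝ, ℂ)) : w (SchwartzMap.eulerCLM f) = -a * w f := by
  have h1 := (w.continuous.tendsto _).comp f.tendsto_dilationCLM_slope
  have h2 : HasDerivAt (fun r : ℝ => Complex.exp (-r * a) * w f) (-a * w f) 0 := by
    have := (((Complex.ofRealCLM.hasDerivAt (x := 0)).neg.mul_const a).cexp).mul_const (w f)
    simpa using this
  rw [hasDerivAt_iff_tendsto_slope_zero] at h2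
  refine tendsto_nhds_unique h1 (h2.congr fun r => ?_)
  simp [hw]

/-- The average `∫₀¹ s^(b-1) f(s t) ds`, which solves `t h' + b h = f`. -/
noncomputable def hardyAverage (b : ℂ) (f : ℝ → ℂ) (t : ℝ) : ℂ :=
  ∫ s in (0 : ℝ)..1, (s : ℂ) ^ (b - 1) * f (s * t)

theorem intervalIntegrable_cpow_mul_comp {b : ℂ} (hb : 0 < b.re) {f : ℝ → ℂ} (hf : Continuous f)
    (t : ℝ) : IntervalIntegrable (fun s : ℝ => (s : ℂ) ^ (b - 1) * f (s * t)) volume 0 1 :=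
  (intervalIntegral.intervalIntegrable_cpow' (by simpa using hb)).mul_continuousOn (by fun_prop)

namespace SchwartzMap

theorem hasDerivAt_hardyAverage {b : ℂ} (hb : 0 < b.re) (f : 𝓢(ℝ, ℂ)) (t : ℝ) :
    HasDerivAt (hardyAverage b f) (hardyAverage (b + 1) (derivCLM ℂ ℂ f) t) t := by
  have hb' : 0 < (b + 1).re := by simp; linarith
  refine (intervalIntegral.hasDerivAt_integral_of_dominated_loc_of_deriv_le
    (F := fun x s => (s : ℂ) ^ (b - 1) * f (s * x))
    (F' := fun x s => (s : ℂ) ^ (b + 1 - 1) * derivCLM ℂ ℂ f (s * x))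
    (bound := fun _ => SchwartzMap.seminorm ℂ 0 0 (derivCLM ℂ ℂ f)) univ_mem ?_
    (intervalIntegrable_cpow_mul_comp hb f.continuous t) ?_ ?_ (by simp) ?_).2
  · refine Eventually.of_forall fun x => ?_
    have := (intervalIntegrable_cpow_mul_comp hb f.continuous x).aestronglyMeasurable
    rwa [Set.uIoc_of_le zero_le_one]
  · have := (intervalIntegrable_cpow_mul_comp hb' (derivCLM ℂ ℂ f).continuous
      t).aestronglyMeasurable
    rwa [Set.uIoc_of_le zero_le_one]
  · refine Eventually.of_forall fun s hs x _ => ?_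
    rw [Set.uIoc_of_le zero_le_one] at hs
    rw [norm_mul, Complex.norm_cpow_eq_rpow_re_of_pos hs.1]
    refine (mul_le_of_le_one_left (norm_nonneg _) ?_).trans (norm_le_seminorm ℂ _ _)
    exact Real.rpow_le_one hs.1.le hs.2 (by simpa using hb.le)
  · refine Eventually.of_forall fun s hs x _ => ?_
    rw [Set.uIoc_of_le zero_le_one] at hs
    have hs0 : (s : ℂ) ≠ 0 := Complex.ofReal_ne_zero.2 hs.1.ne'
    have h := ((f.hasDerivAt (s * x)).scomp x ((hasDerivAt_id x).const_mul s)).const_mul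
      ((s : ℂ) ^ (b - 1))
    refine h.congr_deriv ?_
    rw [show b + 1 - 1 = (b - 1) + 1 by ring, Complex.cpow_add _ _ hs0]
    simp
    ring

theorem deriv_hardyAverage {b : ℂ} (hb : 0 < b.re) (f : 𝓢(ℝ, ℂ)) :
    deriv (hardyAverage b f) = hardyAverage (b + 1) (derivCLM ℂ ℂ f) :=
  funext fun t => (hasDerivAt_hardyAverage hb f t).deriv

theorem contDiff_hardyAverage {b : ℂ} (hb : 0 < b.re) (f : 𝓢(ℝ, ℂ)) :
    ContDiff ℝ ∞ (hardyAverage b f) := by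
  rw [contDiff_infty]
  intro n
  induction n generalizing b f with
  | zero =>
    refine contDiff_zero.2 (Differentiable.continuous (𝕜 := ℝ) fun t => ?_)
    exact (hasDerivAt_hardyAverage hb f t).differentiableAt
  | succ n ih =>
    push_cast
    rw [contDiff_succ_iff_deriv, deriv_hardyAverage hb]
    exact ⟨fun t => (hasDerivAt_hardyAverage hb f t).differentiableAt, by simp,
      ih (by simp; linarith) _⟩

theorem mul_deriv_hardyAverage_add {b : ℂ} (hb : 0 < b.re) (f : 𝓢(ℝ, ℂ)) (t : ℝ) :
    t * deriv (hardyAverage b f) t + b * hardyAverage b f t = f t := by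
  have hb' : 0 < (b + 1).re := by simp; linarith
  have hb0 : b ≠ 0 := by rintro rfl; simp at hb
  have i1 := intervalIntegrable_cpow_mul_comp hb f.continuous t
  have i2 := intervalIntegrable_cpow_mul_comp hb' (derivCLM ℂ ℂ f).continuous t
  have key := intervalIntegral.integral_eq_sub_of_hasDerivAt_of_le (a := 0) (b := 1)
    (f := fun s : ℝ => (s : ℂ) ^ b * f (s * t)) zero_le_one
    ((Complex.continuous_ofReal_cpow_const hb).mul (by fun_prop)).continuousOn
    (fun s hs => by
      refine ((hasDerivAt_ofReal_cpow_const hs.1.ne' hb0).mul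
        ((f.hasDerivAt (s * t)).scomp s ((hasDerivAt_id s).mul_const t))).congr_deriv
          (g' := t * ((s : ℂ) ^ (b + 1 - 1) * derivCLM ℂ ℂ f (s * t)) +
            b * ((s : ℂ) ^ (b - 1) * f (s * t))) ?_
      simp
      ring)
    ((i2.const_mul _).add (i1.const_mul _))
  rw [intervalIntegral.integral_add (i2.const_mul _) (i1.const_mul _),
    intervalIntegral.integral_const_mul, intervalIntegral.integral_const_mul] at key
  rw [deriv_hardyAverage hb, hardyAverage, hardyAverage, key]
  simp [hb0]

theorem mellinConvergent (f : 𝓢(ℝ, ℂ)) {b : ℂ} (hb : 0 < b.re) : MellinConvergent f b := by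
  refine mellinConvergent_of_isBigO_rpow (a := b.re + 1) (b := 0)
    (f.continuous.locallyIntegrable.locallyIntegrableOn _) ?_ (by simp) ?_ hb
  · refine ((f.isBigO_cocompact_rpow (-(b.re + 1))).mono atTop_le_cocompact).congr' .rfl ?_
    filter_upwards [eventually_ge_atTop 0] with x hx
    simp [abs_of_nonneg hx]
  · simpa using (f.continuous.tendsto 0).isBigO_one ℝ |>.mono nhdsWithin_le_nhds

/-- The reflection `f ↦ f(-t)` on Schwartz functions. -/
noncomputable def reflectCLM : 𝓢(ℝ, ℂ) →L[ℂ] 𝓢(ℝ, ℂ) :=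
  compCLMOfContinuousLinearEquiv ℂ (ContinuousLinearEquiv.neg ℝ)

@[simp]
theorem reflectCLM_apply (f : 𝓢(ℝ, ℂ)) (t : ℝ) : reflectCLM f t = f (-t) := rfl

theorem mellin_comp_mul_eq_zero (f : 𝓢(ℝ, ℂ)) {b : ℂ} (hb : 0 < b.re) (h₁ : mellin f b = 0)
    (h₂ : mellin (reflectCLM f) b = 0) {t : ℝ} (ht : t ≠ 0) :
    MellinConvergent (fun s => f (s * t)) b ∧ mellin (fun s => f (s * t)) b = 0 := by
  rcases ht.lt_or_gt with ht | ht
  · have e : (fun s => f (s * t)) = fun s => reflectCLM f (-t * s) := by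
      ext s; simp [mul_comm]
    rw [e, MellinConvergent.comp_mul_left (neg_pos.2 ht), mellin_comp_mul_left _ _ (neg_pos.2 ht),
      h₂]
    exact ⟨mellinConvergent _ hb, by simp⟩
  · simp_rw [mul_comm _ t]
    rw [MellinConvergent.comp_mul_left ht, mellin_comp_mul_left _ _ ht, h₁]
    exact ⟨mellinConvergent _ hb, by simp⟩

theorem hardyAverage_eq_neg_integral_Ioi (f : 𝓢(ℝ, ℂ)) {b : ℂ} (hb : 0 < b.re)
    (h₁ : mellin f b = 0) (h₂ : mellin (reflectCLM f) b = 0) {t : ℝ} (ht : t ≠ 0) :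
    hardyAverage b f t = -∫ s in Set.Ioi (1 : ℝ), (s : ℂ) ^ (b - 1) * f (s * t) := by
  obtain ⟨hc, h0⟩ := mellin_comp_mul_eq_zero f hb h₁ h₂ ht
  rw [MellinConvergent] at hc
  rw [mellin] at h0
  rw [← Set.Ioc_union_Ioi_eq_Ioi zero_le_one] at hc h0
  rw [setIntegral_union Set.Ioc_disjoint_Ioi_same measurableSet_Ioi hc.left_of_union
    hc.right_of_union] at h0
  rw [hardyAverage, intervalIntegral.integral_of_le zero_le_one]
  exact eq_neg_of_add_eq_zero_left h0

theorem exists_pow_mul_hardyAverage_le (f : 𝓢(ℝ, ℂ)) {b : ℂ} (hb : 0 < b.re)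
    (h₁ : mellin f b = 0) (h₂ : mellin (reflectCLM f) b = 0) (k : ℕ) :
    ∃ C, ∀ t : ℝ, 1 ≤ ‖t‖ → ‖t‖ ^ k * ‖hardyAverage b f t‖ ≤ C := by
  obtain ⟨j, hj⟩ := exists_nat_gt b.re
  set N := k + j
  have hN : b.re < N := by push_cast [N]; linarith [Nat.cast_nonneg (α := ℝ) k]
  set M := SchwartzMap.seminorm ℂ N 0 f
  refine ⟨∫ s in Set.Ioi (1 : ℝ), s ^ (b.re - 1 - N) * M, fun t ht => ?_⟩
  have ht0 : t ≠ 0 := by rintro rfl; simp at ht; linarith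
  have htp : 0 < ‖t‖ := by positivity
  have hpow : ‖t‖ ^ k ≤ ‖t‖ ^ N := pow_le_pow_right₀ ht (by simp [N])
  refine (mul_le_mul_of_nonneg_right hpow (norm_nonneg _)).trans ?_
  rw [hardyAverage_eq_neg_integral_Ioi f hb h₁ h₂ ht0, norm_neg, ← le_div_iff₀' (by positivity),
    div_eq_mul_inv, ← integral_mul_const]
  refine norm_integral_le_of_norm_le ?_ ?_
  · exact ((integrableOn_Ioi_rpow_of_lt (by linarith) one_pos).mul_const _).mul_const _
  · refine (ae_restrict_iff' measurableSet_Ioi).2 (Eventually.of_forall fun s hs => ?_)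
    have hs : 0 < s := one_pos.trans hs
    rw [norm_mul, Complex.norm_cpow_eq_rpow_re_of_pos hs, Real.rpow_sub hs, Real.rpow_natCast]
    have hf := f.norm_pow_mul_le_seminorm ℂ N (s * t)
    rw [norm_mul, mul_pow, Real.norm_of_nonneg hs.le] at hf
    calc s ^ (b - 1).re * ‖f (s * t)‖
        = s ^ (b.re - 1) / s ^ N * (s ^ N * ‖t‖ ^ N * ‖f (s * t)‖) * (‖t‖ ^ N)⁻¹ := by
          simp
          field_simp
      _ ≤ _ := by gcongr

theorem exists_pow_mul_iteratedDeriv_hardyAverage_le (f : 𝓢(ℝ, ℂ)) {b : ℂ} (hb : 0 < b.re)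
    (h₁ : mellin f b = 0) (h₂ : mellin (reflectCLM f) b = 0) (k n : ℕ) :
    ∃ C, ∀ t : ℝ, 1 ≤ ‖t‖ → ‖t‖ ^ k * ‖iteratedDeriv n (hardyAverage b f) t‖ ≤ C := by
  induction n generalizing k with
  | zero => simpa using exists_pow_mul_hardyAverage_le f hb h₁ h₂ k
  | succ n ih =>
    obtain ⟨C, hC⟩ := ih k
    refine ⟨SchwartzMap.seminorm ℂ k n f + ‖(n : ℂ) + b‖ * C, fun t ht => ?_⟩
    have hs := contDiff_hardyAverage hb f
    have ode : iteratedDeriv n f t = t * iteratedDeriv (n + 1) (hardyAverage b f) t +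
        (n + b) * iteratedDeriv n (hardyAverage b f) t := by
      have e : ⇑f = fun t : ℝ => t * deriv (hardyAverage b f) t + b * hardyAverage b f t :=
        funext fun t => (mul_deriv_hardyAverage_add hb f t).symm
      have hsn : ContDiffAt ℝ n (hardyAverage b f) t := (hs.of_le (mod_cast le_top)).contDiffAt
      have hd : ContDiff ℝ ∞ (deriv (hardyAverage b f)) := (contDiff_infty_iff_deriv.1 hs).2
      have hdn : ContDiffAt ℝ n (deriv (hardyAverage b f)) t :=
        (hd.of_le (mod_cast le_top)).contDiffAt
      have hof : ContDiffAt ℝ n (fun t : ℝ => (t : ℂ)) t :=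
        Complex.ofRealCLM.contDiff.contDiffAt
      conv_lhs => rw [e]
      rw [iteratedDeriv_fun_add (hof.mul hdn)
        (contDiffAt_const.mul hsn), iteratedDeriv_const_mul _ hsn,
        iteratedDeriv_ofReal_mul_deriv hs]
      ring
    have h1 : ‖t‖ * ‖iteratedDeriv (n + 1) (hardyAverage b f) t‖ ≤
        ‖iteratedDeriv n f t‖ + ‖(n : ℂ) + b‖ * ‖iteratedDeriv n (hardyAverage b f) t‖ := by
      rw [← Complex.norm_real, ← norm_mul, ← norm_mul, eq_sub_of_add_eq ode.symm]
      exact norm_sub_le _ _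
    calc ‖t‖ ^ k * ‖iteratedDeriv (n + 1) (hardyAverage b f) t‖
        ≤ ‖t‖ ^ k * (‖t‖ * ‖iteratedDeriv (n + 1) (hardyAverage b f) t‖) := by
          gcongr
          exact le_mul_of_one_le_left (norm_nonneg _) ht
      _ ≤ ‖t‖ ^ k * (‖iteratedDeriv n f t‖ +
            ‖(n : ℂ) + b‖ * ‖iteratedDeriv n (hardyAverage b f) t‖) := by gcongr
      _ = ‖t‖ ^ k * ‖iteratedDeriv n f t‖ +
            ‖(n : ℂ) + b‖ * (‖t‖ ^ k * ‖iteratedDeriv n (hardyAverage b f) t‖) := by ring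
      _ ≤ _ := by
        gcongr
        · exact f.le_seminorm' ℂ k n t
        · exact hC t ht

theorem exists_eulerCLM_add_smul_eq_of_re_pos (f : 𝓢(ℝ, ℂ)) {b : ℂ} (hb : 0 < b.re)
    (h₁ : mellin f b = 0) (h₂ : mellin (reflectCLM f) b = 0) :
    ∃ h : 𝓢(ℝ, ℂ), eulerCLM h + b • h = f := by
  have hs := contDiff_hardyAverage hb f
  refine ⟨⟨hardyAverage b f, hs, fun k n => ?_⟩, ?_⟩
  · obtain ⟨C, hC⟩ := exists_pow_mul_iteratedDeriv_hardyAverage_le f hb h₁ h₂ k n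
    have hc : Continuous fun t : ℝ => ‖t‖ ^ k * ‖iteratedDeriv n (hardyAverage b f) t‖ := by
      have := hs.continuous_iteratedDeriv n (mod_cast le_top)
      fun_prop
    obtain ⟨C', hC'⟩ := (isCompact_closedBall (0 : ℝ) 1).bddAbove_image hc.continuousOn
    refine ⟨max C C', fun t => ?_⟩
    rw [norm_iteratedFDeriv_eq_norm_iteratedDeriv]
    rcases le_total 1 ‖t‖ with ht | ht
    · exact (hC t ht).trans (le_max_left _ _)
    · exact (hC' ⟨t, by simpa using ht, rfl⟩).trans (le_max_right _ _)
  · ext t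
    simp only [add_apply, smul_apply, eulerCLM_apply]
    exact mul_deriv_hardyAverage_add hb f t

theorem exists_coe_eq_iteratedDeriv (f : 𝓢(ℝ, ℂ)) (k : ℕ) :
    ∃ g : 𝓢(ℝ, ℂ), ⇑g = iteratedDeriv k f := by
  induction k generalizing f with
  | zero => exact ⟨f, by simp⟩
  | succ k ih =>
    obtain ⟨g, hg⟩ := ih (derivCLM ℂ ℂ f)
    exact ⟨g, by rw [hg, iteratedDeriv_succ']; rfl⟩

theorem exists_eulerCLM_add_smul_eq (k : ℕ) {a : ℂ} (ha : ∀ j : ℕ, a ≠ -(j : ℂ))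
    (hk : 0 < a.re + k) (f : 𝓢(ℝ, ℂ)) (h₁ : mellin (iteratedDeriv k f) (a + k) = 0)
    (h₂ : mellin (fun t => iteratedDeriv k f (-t)) (a + k) = 0) :
    ∃ h : 𝓢(ℝ, ℂ), eulerCLM h + a • h = f := by
  induction k generalizing a f with
  | zero =>
    refine exists_eulerCLM_add_smul_eq_of_re_pos f (by simpa using hk) (by simpa using h₁) ?_
    have e : ⇑(reflectCLM f) = fun t => f (-t) := rfl
    simpa [e] using h₂
  | succ k ih =>
    have ha0 : a ≠ 0 := by simpa using ha 0
    have e : a + (k + 1 : ℕ) = a + 1 + k := by push_cast; ring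
    rw [iteratedDeriv_succ', e] at h₁ h₂
    obtain ⟨g, hg⟩ := ih (a := a + 1)
      (fun j hj => ha (j + 1) (by push_cast; linear_combination hj))
      (by push_cast at hk; simp; linarith) (derivCLM ℂ ℂ f) h₁ h₂
    set m : 𝓢(ℝ, ℂ) →L[ℂ] 𝓢(ℝ, ℂ) := smulLeftCLM ℂ (fun t : ℝ => (t : ℂ))
    have hm (u : 𝓢(ℝ, ℂ)) (t : ℝ) : m u t = t * u t := by
      have h : (fun t : ℝ => (t : ℂ)).HasTemperateGrowth := Complex.ofRealCLM.hasTemperateGrowth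
      simp [m, smulLeftCLM_apply_apply h]
    have hgt (t : ℝ) : t * deriv g t + (a + 1) * g t = deriv f t := by
      simpa [eulerCLM_apply] using congrArg (fun u : 𝓢(ℝ, ℂ) => u t) hg
    refine ⟨a⁻¹ • (f - m g), ?_⟩
    ext t
    have hcoe : ⇑(a⁻¹ • (f - m g)) = fun t : ℝ => a⁻¹ * (f t - t * g t) := by
      ext t; simp [hm]
    have hder : deriv (⇑(a⁻¹ • (f - m g))) t = g t := by
      rw [hcoe]
      refine (((f.hasDerivAt t).sub ((Complex.ofRealCLM.hasDerivAt (x := t)).mul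
        (g.hasDerivAt t))).const_mul a⁻¹).deriv.trans ?_
      rw [← hgt t]
      simp
      field_simp
      ring
    rw [add_apply, eulerCLM_apply, hder, smul_apply, hcoe]
    simp [ha0]

end SchwartzMap

theorem Ta_eq_mellin (a : ℂ) (k : ℕ) (ψ : ℝ → ℂ) :
    Ta a k ψ = ((-1 : ℂ) ^ k / ∏ j ∈ Finset.range k, (a + (j : ℂ))) *
      mellin (iteratedDeriv k ψ) (a + k) := rfl

theorem Ta_eq_zero_iff {a : ℂ} (ha : ∀ j : ℕ, a ≠ -(j : ℂ)) (k : ℕ) (ψ : ℝ → ℂ) :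
    Ta a k ψ = 0 ↔ mellin (iteratedDeriv k ψ) (a + k) = 0 := by
  have h : ∏ j ∈ Finset.range k, (a + (j : ℂ)) ≠ 0 :=
    Finset.prod_ne_zero_iff.2 fun j _ h => ha j (eq_neg_of_add_eq_zero_left h)
  simp [Ta_eq_mellin, h]

namespace SchwartzMap

theorem mellinConvergent_iteratedDeriv (f : 𝓢(ℝ, ℂ)) (k : ℕ) {b : ℂ} (hb : 0 < b.re) :
    MellinConvergent (iteratedDeriv k f) b := by
  obtain ⟨g, hg⟩ := f.exists_coe_eq_iteratedDeriv k
  exact hg ▸ g.mellinConvergent hb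

/-- The pairing `Ta a k` as a linear functional on Schwartz functions. -/
noncomputable def TaLM (a : ℂ) (k : ℕ) (hk : 0 < a.re + k) : 𝓢(ℝ, ℂ) →ₗ[ℂ] ℂ where
  toFun f := Ta a k f
  map_add' f g := by
    have hb : 0 < (a + k).re := by simpa using hk
    have e : iteratedDeriv k (⇑(f + g)) = fun t => iteratedDeriv k f t + iteratedDeriv k g t := by
      ext t
      exact iteratedDeriv_add (f.smooth k).contDiffAt (g.smooth k).contDiffAt
    simp only [Ta_eq_mellin]
    rw [e, (hasMellin_add (f.mellinConvergent_iteratedDeriv k hb)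
      (g.mellinConvergent_iteratedDeriv k hb)).2, mul_add]
  map_smul' c f := by
    have e : iteratedDeriv k (⇑(c • f)) = fun t => c • iteratedDeriv k f t := by
      ext t
      exact iteratedDeriv_const_mul c (f.smooth k).contDiffAt
    simp only [Ta_eq_mellin]
    rw [e, mellin_const_smul]
    simp only [smul_eq_mul, RingHom.id_apply]
    ring

theorem mellin_iteratedDeriv_comp_neg_eq_zero {b : ℂ} {k : ℕ} {f : ℝ → ℂ}
    (h : mellin (iteratedDeriv k fun t => f (-t)) b = 0) :
    mellin (fun t => iteratedDeriv k f (-t)) b = 0 := by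
  have e : (iteratedDeriv k fun t => f (-t)) =
      fun t => ((-1 : ℂ) ^ k) • iteratedDeriv k f (-t) := by
    ext t
    rw [iteratedDeriv_comp_neg]
    simp
  rw [e, mellin_const_smul] at h
  simpa using h

end SchwartzMap

theorem LinearMap.exists_comp_comp_eq_self {K V W : Type*} [Field K] [AddCommGroup V] [Module K V]
    [AddCommGroup W] [Module K W] (L : V →ₗ[K] W) :
    ∃ g : W →ₗ[K] V, ∀ v, L (g (L v)) = L v := by
  obtain ⟨g, hg⟩ := L.rangeRestrict.exists_rightInverse_of_surjective L.range_rangeRestrict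
  obtain ⟨g', hg'⟩ := LinearMap.exists_extend g
  refine ⟨g', fun v => ?_⟩
  have h1 : g' (L v) = g (L.rangeRestrict v) := LinearMap.congr_fun hg' (L.rangeRestrict v)
  rw [h1]
  exact congrArg Subtype.val (LinearMap.congr_fun hg (L.rangeRestrict v))

/-- Homogeneous tempered distributions on the line annihilate the common kernel of the two
pairings. -/
theorem apply_eq_zero_of_homogeneous {a : ℂ} (ha : ∀ j : ℕ, a ≠ -(j : ℂ)) {k : ℕ}
    (hk : 0 < a.re + k) (w : 𝓢(ℝ, ℂ) →L[ℂ] ℂ)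
    (hw : ∀ (r : ℝ) (f : 𝓢(ℝ, ℂ)), w (SchwartzMap.dilationCLM r f) = Complex.exp (-r * a) * w f)
    {f : 𝓢(ℝ, ℂ)} (h₁ : Ta a k f = 0) (h₂ : Ta a k (fun t => f (-t)) = 0) : w f = 0 := by
  rw [Ta_eq_zero_iff ha] at h₁ h₂
  obtain ⟨h, rfl⟩ := SchwartzMap.exists_eulerCLM_add_smul_eq k ha hk f h₁
    (SchwartzMap.mellin_iteratedDeriv_comp_neg_eq_zero h₂)
  simp [apply_eulerCLM_of_homogeneous w a hw]

/-- If `a ∈ ℂ` is not a nonpositive integer and `u` is a tempered distribution on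
`ℝ^m × ℝ` homogeneous of degree `a` for the dilation action in the last variable, and
`k ∈ ℕ` with `Re(a) + k > 0`, then there are tempered distributions `v₊, v₋` on `ℝ^m` with
`u(φ ⊗ ψ) = v₊(φ)·T_a(ψ) + v₋(φ)·T_a(ψ̌)` for all Schwartz `φ, ψ`, where `ψ̌(t) = ψ(−t)`. -/
theorem stmt_3 (m : ℕ) (a : ℂ) (ha : ∀ j : ℕ, a ≠ -(j : ℂ))
    (u : SchwartzMap ((Fin m → ℝ) × ℝ) ℂ →L[ℂ] ℂ)
    (hhom : ∀ s : ℝ, 0 < s → ∀ Φ Ψ : SchwartzMap ((Fin m → ℝ) × ℝ) ℂ,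
      (∀ (p : Fin m → ℝ) (t : ℝ), Ψ (p, t) = Φ (p, s⁻¹ * t)) →
      u Ψ = (s : ℂ) ^ a * u Φ)
    (k : ℕ) (hk : 0 < a.re + k) :
    ∃ vp vm : SchwartzMap (Fin m → ℝ) ℂ →L[ℂ] ℂ,
      ∀ (φ : SchwartzMap (Fin m → ℝ) ℂ) (ψ : SchwartzMap ℝ ℂ)
        (Φ : SchwartzMap ((Fin m → ℝ) × ℝ) ℂ),
        (∀ (p : Fin m → ℝ) (t : ℝ), Φ (p, t) = φ p * ψ t) →
        u Φ = vp φ * Ta a k (fun t => ψ t) + vm φ * Ta a k (fun t => ψ (-t)) := by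
  set T := SchwartzMap.TaLM a k hk
  set L : 𝓢(ℝ, ℂ) →ₗ[ℂ] ℂ × ℂ := T.prod (T ∘ₗ SchwartzMap.reflectCLM.toLinearMap)
  obtain ⟨g, hg⟩ := L.exists_comp_comp_eq_self
  refine ⟨u ∘L SchwartzMap.tensorLeftCLM (g (1, 0)), u ∘L SchwartzMap.tensorLeftCLM (g (0, 1)),
    fun φ ψ Φ hΦ => ?_⟩
  set w := u ∘L SchwartzMap.tensorRightCLM (F := ℝ) φ
  have hw (r : ℝ) (f : 𝓢(ℝ, ℂ)) :
      w (SchwartzMap.dilationCLM r f) = Complex.exp (-r * a) * w f := by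
    have h := hhom (Real.exp (-r)) (Real.exp_pos _) (SchwartzMap.tensorRightCLM φ f)
      (SchwartzMap.tensorRightCLM φ (SchwartzMap.dilationCLM r f)) fun p t => by
        simp [SchwartzMap.coe_dilationCLM, Real.exp_neg]
    rw [Complex.cpow_def_of_ne_zero (by simp), ← Complex.ofReal_log (Real.exp_pos _).le,
      Real.log_exp] at h
    simpa [w] using h
  have hL : L (ψ - g (L ψ)) = 0 := by rw [map_sub, hg, sub_self]
  have hker : w (ψ - g (L ψ)) = 0 :=
    apply_eq_zero_of_homogeneous ha hk w hw (congrArg Prod.fst hL) (congrArg Prod.snd hL)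
  have hsplit : L ψ = Ta a k (fun t => ψ t) • ((1, 0) : ℂ × ℂ) +
      Ta a k (fun t => ψ (-t)) • ((0, 1) : ℂ × ℂ) := by
    ext <;> simp [L] <;> rfl
  have hu : u Φ = w ψ := by
    have : Φ = SchwartzMap.tensorRightCLM φ ψ := by
      ext ⟨p, t⟩
      exact hΦ p t
    rw [this]
    rfl
  have hv (χ : 𝓢(ℝ, ℂ)) : (u ∘L SchwartzMap.tensorLeftCLM χ) φ = w χ := rfl
  rw [hu, hv, hv, ← sub_add_cancel ψ (g (L ψ)), map_add, hker, hsplit, map_add, map_add, map_smul,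
    map_smul, map_smul, map_smul]
  simp
  ring
end

section
/- Let m' ∈ ℕ, m ∈ ℕ, and let u be a tempered distribution on ℝ^{m'} × ℝ that is homogeneous of degree a = −m for the dilation action in the last variable, i.e. for every s > 0 and all Schwartz Φ, Ψ on ℝ^{m'} × ℝ with Ψ(p, t) = Φ(p, s⁻¹t) pointwise, u(Ψ) = s^{−m}·u(Φ). For ψ ∈ 𝓢(ℝ, ℂ) set T(ψ) = ∫₀^∞ (log t) · ψ^{(m+1)}(t) dt, where ψ^{(m+1)} is the (m+1)-st derivative. Then there exist tempered distributions v and v₀ on ℝ^{m'} such that for every φ ∈ 𝓢(ℝ^{m'}, ℂ), every ψ ∈ 𝓢(ℝ, ℂ), and every Schwartz Φ on ℝ^{m'} × ℝ with Φ(p, t) = φ(p)·ψ(t) pointwise, one has u(Φ) = v(φ)·(T(ψ) + (−1)^{m+1}·T(ψ̌)) + v₀(φ)·ψ^{(m)}(0), where ψ̌(t) = ψ(−t). -/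
open MeasureTheory

/-- The log-regularized pairing `T(ψ) = ∫₀^∞ log t · ψ^{(m+1)}(t) dt` with `t_+^{−m−1}`. -/
noncomputable def Tlog (m : ℕ) (ψ : ℝ → ℂ) : ℂ :=
  ∫ t in Set.Ioi (0 : ℝ), (Real.log t : ℂ) * iteratedDeriv (m + 1) ψ t

open Filter Topology
open scoped SchwartzMap FourierTransform LineDeriv

namespace SchwartzMap

/-- A Schwartz function on the line is determined by its derivative. -/
theorem derivCLM_injective : Function.Injective (derivCLM ℂ ℂ) := by
  rw [injective_iff_map_eq_zero]
  intro f hf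
  have hd : ∀ x, deriv f x = 0 := fun x => by
    rw [← derivCLM_apply ℂ, hf]; rfl
  have hc := is_const_of_deriv_eq_zero (𝕜 := ℝ) (fun x => (f.hasDerivAt x).differentiableAt) hd
  have h0 : Tendsto f (cocompact ℝ) (𝓝 0) := f.tendsto_cocompact
  ext x
  have h1 : Tendsto f (cocompact ℝ) (𝓝 (f x)) :=
    tendsto_const_nhds.congr fun y => hc x y
  exact tendsto_nhds_unique h1 h0

theorem seminorm_succ_le (f : 𝓢(ℝ, ℂ)) (k n : ℕ) :
    SchwartzMap.seminorm ℂ k (n + 1) f ≤ SchwartzMap.seminorm ℂ k n (derivCLM ℂ ℂ f) := by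
  refine seminorm_le_bound' ℂ k (n + 1) f (apply_nonneg _ _) fun x => ?_
  have := le_seminorm' ℂ k n (derivCLM ℂ ℂ f) x
  rwa [show ⇑(derivCLM ℂ ℂ f) = deriv f from rfl, ← iteratedDeriv_succ'] at this

/-- A Schwartz function of integral zero has a Schwartz primitive. -/
theorem exists_derivCLM_eq (f : 𝓢(ℝ, ℂ)) (hf : ∫ x, f x = 0) :
    ∃ F : 𝓢(ℝ, ℂ), derivCLM ℂ ℂ F = f := by
  let G : ℝ → ℂ := fun x => ∫ t in Set.Iic x, f t
  have hder : ∀ x, HasDerivAt G (f x) x := by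
    intro x
    have h1 : ∀ y, G y = (∫ t in Set.Iic 0, f t) + ∫ t in (0 : ℝ)..y, f t := fun y => by
      rw [← intervalIntegral.integral_Iic_sub_Iic f.integrable.integrableOn
        f.integrable.integrableOn, add_sub_cancel]
    rw [funext h1]
    exact (intervalIntegral.integral_hasDerivAt_right
      f.integrable.intervalIntegrable (f.continuous.stronglyMeasurableAtFilter _ _)
      f.continuous.continuousAt).const_add _
  have hG' : deriv G = f := funext fun x => (hder x).deriv
  have hsmooth : ContDiff ℝ (⊤ : ℕ∞) G := by
    rw [contDiff_infty_iff_deriv, hG']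
    exact ⟨fun x => (hder x).differentiableAt, f.smooth _⟩
  have hbound : ∀ k x, ‖x‖ ^ k * ‖G x‖ ≤ ∫ t, ‖t‖ ^ k * ‖f t‖ := by
    intro k x
    have key : ∀ S : Set ℝ, MeasurableSet S → (∀ t ∈ S, ‖x‖ ≤ ‖t‖) →
        ‖x‖ ^ k * ‖∫ t in S, f t‖ ≤ ∫ t, ‖t‖ ^ k * ‖f t‖ := by
      intro S hS hxS
      calc ‖x‖ ^ k * ‖∫ t in S, f t‖ ≤ ‖x‖ ^ k * ∫ t in S, ‖f t‖ := by
            gcongr; exact norm_integral_le_integral_norm _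
        _ = ∫ t in S, ‖x‖ ^ k * ‖f t‖ := (integral_const_mul _ _).symm
        _ ≤ ∫ t in S, ‖t‖ ^ k * ‖f t‖ := by
            refine setIntegral_mono_on (f.integrable.norm.const_mul _).integrableOn
              (f.integrable_pow_mul volume k).integrableOn hS fun t ht => ?_
            gcongr
            exact hxS t ht
        _ ≤ ∫ t, ‖t‖ ^ k * ‖f t‖ :=
            setIntegral_le_integral (f.integrable_pow_mul volume k)
              (Eventually.of_forall fun t => by positivity)
    rcases le_total x 0 with hx | hx
    · refine key _ measurableSet_Iic fun t ht => ?_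
      rw [Real.norm_of_nonpos hx, Real.norm_of_nonpos (le_trans ht hx)]
      exact neg_le_neg ht
    · have h2 : G x = -∫ t in Set.Ioi x, f t := by
        have := intervalIntegral.integral_Iic_add_Ioi (b := x) (f.integrable (μ := volume)).integrableOn
          (f.integrable (μ := volume)).integrableOn
        rw [hf] at this
        exact eq_neg_of_add_eq_zero_left this
      rw [h2, norm_neg]
      refine key _ measurableSet_Ioi fun t ht => ?_
      rw [Real.norm_of_nonneg hx, Real.norm_of_nonneg (hx.trans (le_of_lt ht))]
      exact le_of_lt ht
  refine ⟨⟨G, hsmooth, fun k n => ?_⟩, ?_⟩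
  · rcases n with _ | n
    · exact ⟨_, fun x => by simpa using hbound k x⟩
    · refine ⟨SchwartzMap.seminorm ℂ k n f, fun x => ?_⟩
      rw [norm_iteratedFDeriv_eq_norm_iteratedDeriv, iteratedDeriv_succ', hG']
      exact le_seminorm' ℂ k n f x
  · ext x
    exact (hder x).deriv

/-- Multiplication of a Schwartz function by the coordinate. -/
noncomputable def mulId : 𝓢(ℝ, ℂ) →L[ℂ] 𝓢(ℝ, ℂ) := smulLeftCLM ℂ (fun t : ℝ => (t : ℂ))

@[simp]
theorem mulId_apply (f : 𝓢(ℝ, ℂ)) (t : ℝ) : mulId f t = t * f t := by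
  rw [mulId, smulLeftCLM_apply_apply Function.Complex.hasTemperateGrowth_ofReal]; rfl

/-- A Schwartz function vanishing at the origin is divisible by the coordinate. -/
theorem exists_mulId_eq (g : 𝓢(ℝ, ℂ)) (hg : g 0 = 0) : ∃ h : 𝓢(ℝ, ℂ), mulId h = g := by
  have hint : ∫ x, 𝓕 g x = 0 := by
    have : 𝓕⁻ (𝓕 g) 0 = 0 := by rw [FourierTransform.fourierInv_fourier_eq, hg]
    rw [fourierInv_coe, Real.fourierInv_eq] at this
    simpa using this
  obtain ⟨H, hH⟩ := exists_derivCLM_eq _ hint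
  have hH' : ∂_{(1 : ℝ)} H = 𝓕 g := by
    rw [← hH]
    ext x
    rw [lineDerivOp_apply_eq_fderiv, derivCLM_apply, fderiv_apply_one_eq_deriv]
  refine ⟨(-(2 * Real.pi * Complex.I)) • 𝓕⁻ H, ?_⟩
  have h := fourierInv_lineDerivOp_eq H (1 : ℝ)
  rw [hH', FourierTransform.fourierInv_fourier_eq] at h
  rw [h]
  ext x
  have : (inner ℝ · (1 : ℝ)).HasTemperateGrowth := by fun_prop
  rw [mulId_apply, smul_apply, smul_apply, smulLeftCLM_apply_apply this]
  simp
  ring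

/-- The Euler operator `t d/dt`. -/
noncomputable def euler : 𝓢(ℝ, ℂ) →L[ℂ] 𝓢(ℝ, ℂ) := mulId ∘L derivCLM ℂ ℂ

@[simp]
theorem euler_apply (f : 𝓢(ℝ, ℂ)) (t : ℝ) : euler f t = t * deriv f t := by
  simp [euler]

theorem derivCLM_mulId (f : 𝓢(ℝ, ℂ)) :
    derivCLM ℂ ℂ (mulId f) = f + mulId (derivCLM ℂ ℂ f) := by
  ext t
  have h : HasDerivAt (mulId f) (1 * f t + t * deriv f t) t := by
    rw [show ⇑(mulId f) = fun t : ℝ => (t : ℂ) * f t from funext fun t => mulId_apply f t]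
    exact (Complex.ofRealCLM.hasDerivAt (x := t)).mul (f.hasDerivAt t)
  simp [h.deriv]

theorem derivCLM_euler (f : 𝓢(ℝ, ℂ)) :
    derivCLM ℂ ℂ (euler f) = derivCLM ℂ ℂ f + euler (derivCLM ℂ ℂ f) :=
  derivCLM_mulId _

theorem integral_derivCLM (f : 𝓢(ℝ, ℂ)) : ∫ x, derivCLM ℂ ℂ f x = 0 := by
  simpa using integral_of_hasDerivAt_of_tendsto (fun x => f.hasDerivAt x)
    (derivCLM ℂ ℂ f).integrable
    (f.tendsto_cocompact.mono_left _root_.atBot_le_cocompact)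
    (f.tendsto_cocompact.mono_left _root_.atTop_le_cocompact)

/-- The range of `t d/dt - m` contains every `ψ` whose `m`-th derivative is the product of the
coordinate and a Schwartz function of integral zero. -/
theorem exists_euler_sub_eq (m : ℕ) : ∀ (ψ h : 𝓢(ℝ, ℂ)), ((derivCLM ℂ ℂ)^[m] ψ = mulId h) →
    ∫ x, h x = 0 → ∃ η : 𝓢(ℝ, ℂ), euler η - (m : ℂ) • η = ψ := by
  induction m with
  | zero =>
    intro ψ h hψ hh
    obtain ⟨η, rfl⟩ := exists_derivCLM_eq h hh
    exact ⟨η, by simpa [euler] using hψ.symm⟩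
  | succ m ih =>
    intro ψ h hψ hh
    obtain ⟨η, hη⟩ := ih (derivCLM ℂ ℂ ψ) h hψ hh
    have hη0 : ∫ x, η x = 0 := by
      have h1 : derivCLM ℂ ℂ (mulId η - ψ) = (m + 1 : ℂ) • η := by
        rw [map_sub, derivCLM_mulId, ← hη]
        simp only [euler, ContinuousLinearMap.comp_apply]
        module
      have h2 := integral_derivCLM (mulId η - ψ)
      rw [h1] at h2
      simp only [smul_apply, smul_eq_mul, integral_const_mul, mul_eq_zero] at h2
      exact h2.resolve_left (by exact_mod_cast m.succ_ne_zero)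
    obtain ⟨ζ, rfl⟩ := exists_derivCLM_eq η hη0
    refine ⟨ζ, derivCLM_injective ?_⟩
    rw [← hη, map_sub, derivCLM_euler, map_smul]
    push_cast
    module

/-- The dilation `f ↦ f (e^r ·)`. -/
noncomputable def dilation (r : ℝ) : 𝓢(ℝ, ℂ) →L[ℂ] 𝓢(ℝ, ℂ) :=
  compCLMOfContinuousLinearEquiv ℂ
    (ContinuousLinearEquiv.unitsEquivAut ℝ (Units.mk0 (Real.exp r) (Real.exp_ne_zero r)))

@[simp]
theorem dilation_apply (r : ℝ) (f : 𝓢(ℝ, ℂ)) (t : ℝ) :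
    dilation r f t = f (Real.exp r * t) := by
  simp [dilation, mul_comm]

theorem derivCLM_dilation (r : ℝ) (f : 𝓢(ℝ, ℂ)) :
    derivCLM ℂ ℂ (dilation r f) = (Real.exp r : ℂ) • dilation r (derivCLM ℂ ℂ f) := by
  ext t
  have h : HasDerivAt (dilation r f) (Real.exp r • deriv f (Real.exp r * t)) t := by
    rw [show ⇑(dilation r f) = fun t : ℝ => f (Real.exp r * t) from
      funext fun t => dilation_apply r f t]
    have := (f.hasDerivAt (Real.exp r * t)).scomp t ((hasDerivAt_id t).const_mul (Real.exp r))
    simpa [Function.comp_def] using this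
  simp [h.deriv]

/-- The shifted Euler operator `c + t d/dt`, generating the weighted dilations
`f ↦ e^{cr} f (e^r ·)`. -/
noncomputable def eulerAdd (c : ℝ) : 𝓢(ℝ, ℂ) →L[ℂ] 𝓢(ℝ, ℂ) :=
  (c : ℂ) • ContinuousLinearMap.id ℂ 𝓢(ℝ, ℂ) + euler

@[simp]
theorem eulerAdd_apply (c : ℝ) (f : 𝓢(ℝ, ℂ)) (t : ℝ) :
    eulerAdd c f t = c * f t + t * deriv f t := by
  simp [eulerAdd]

/-- The first order Taylor remainder at `r = 0` of the weighted dilations. -/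
noncomputable def dilationRemainder (c r : ℝ) (f : 𝓢(ℝ, ℂ)) : 𝓢(ℝ, ℂ) :=
  (Real.exp (c * r) : ℂ) • dilation r f - f - (r : ℂ) • eulerAdd c f

theorem derivCLM_dilationRemainder (c r : ℝ) (f : 𝓢(ℝ, ℂ)) :
    derivCLM ℂ ℂ (dilationRemainder c r f) = dilationRemainder (c + 1) r (derivCLM ℂ ℂ f) := by
  have he : (Real.exp ((c + 1) * r) : ℂ) = Real.exp (c * r) * Real.exp r := by
    rw [add_mul, one_mul, Real.exp_add]; push_cast; rfl
  simp only [dilationRemainder, eulerAdd, map_sub, map_smul, derivCLM_dilation, he,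
    add_apply, smul_apply, ContinuousLinearMap.id_apply,
    map_add, derivCLM_euler]
  push_cast
  module

theorem hasDerivAt_dilation (c t r : ℝ) (f : 𝓢(ℝ, ℂ)) :
    HasDerivAt (fun r : ℝ => (Real.exp (c * r) : ℂ) * f (Real.exp r * t))
      (Real.exp (c * r) * eulerAdd c f (Real.exp r * t)) r := by
  have h1 : HasDerivAt (fun r : ℝ => (Real.exp (c * r) : ℂ)) (Real.exp (c * r) * c : ℝ) r :=
    (((hasDerivAt_id r).const_mul c).exp.congr_deriv (by simp)).ofReal_comp
  have h2 : HasDerivAt (fun r : ℝ => f (Real.exp r * t))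
      ((Real.exp r * t) • deriv f (Real.exp r * t)) r :=
    (f.hasDerivAt (Real.exp r * t)).scomp r ((Real.hasDerivAt_exp r).mul_const t)
  refine (h1.mul h2).congr_deriv ?_
  rw [eulerAdd_apply, Complex.real_smul]
  push_cast
  ring

theorem norm_pow_mul_dilationRemainder_le (k : ℕ) (c : ℝ) (f : 𝓢(ℝ, ℂ)) {r : ℝ} (hr : 0 ≤ r)
    (hr1 : r ≤ 1) (t : ℝ) :
    |t| ^ k * ‖dilationRemainder c r f t‖ ≤
      Real.exp |c| * SchwartzMap.seminorm ℂ k 0 (eulerAdd c (eulerAdd c f)) * r ^ 2 := by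
  set M := Real.exp |c| * SchwartzMap.seminorm ℂ k 0 (eulerAdd c (eulerAdd c f)) with hM
  let w : ℂ := ((|t| ^ k : ℝ) : ℂ)
  let G : 𝓢(ℝ, ℂ) → ℝ → ℂ := fun g ρ => w * (Real.exp (c * ρ) * g (Real.exp ρ * t))
  have hG : ∀ g ρ, HasDerivAt (G g) (G (eulerAdd c g) ρ) ρ := fun g ρ =>
    (hasDerivAt_dilation c t ρ g).const_mul w
  have hw : ‖w‖ = |t| ^ k := by
    simp [w]
  have hbound : ∀ ρ ∈ Set.Icc 0 r, ‖G (eulerAdd c (eulerAdd c f)) ρ‖ ≤ M := by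
    intro ρ hρ
    simp only [G]
    rw [norm_mul, norm_mul, hw, Complex.norm_real, Real.norm_of_nonneg (Real.exp_pos _).le]
    have h1 : Real.exp (c * ρ) ≤ Real.exp |c| := by
      gcongr
      calc c * ρ ≤ |c| * ρ := by gcongr; exacts [hρ.1, le_abs_self c]
        _ ≤ |c| * 1 := by gcongr; exact hρ.2.trans hr1
        _ = |c| := mul_one _
    have h2 : |t| ^ k ≤ ‖Real.exp ρ * t‖ ^ k := by
      rw [norm_mul, Real.norm_of_nonneg (Real.exp_pos _).le]
      refine pow_le_pow_left₀ (abs_nonneg t) ?_ k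
      exact le_mul_of_one_le_left (abs_nonneg t) (Real.one_le_exp hρ.1)
    calc _ ≤ ‖Real.exp ρ * t‖ ^ k *
          (Real.exp |c| * ‖eulerAdd c (eulerAdd c f) (Real.exp ρ * t)‖) := by gcongr
      _ = Real.exp |c| * (‖Real.exp ρ * t‖ ^ k *
          ‖eulerAdd c (eulerAdd c f) (Real.exp ρ * t)‖) := by ring
      _ ≤ M := by
        rw [hM]
        gcongr
        exact norm_pow_mul_le_seminorm ℂ _ k _
  have h0 : (0 : ℝ) ∈ Set.Icc 0 r := ⟨le_rfl, hr⟩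
  have hfirst : ∀ ρ ∈ Set.Icc 0 r, ‖G (eulerAdd c f) ρ - G (eulerAdd c f) 0‖ ≤ M * r := by
    intro ρ hρ
    have := (convex_Icc 0 r).norm_image_sub_le_of_norm_hasDerivWithin_le
      (fun x _ => (hG (eulerAdd c f) x).hasDerivWithinAt) hbound h0 hρ
    refine this.trans ?_
    rw [sub_zero, Real.norm_of_nonneg hρ.1]
    have : 0 ≤ M := by positivity
    gcongr
    exact hρ.2
  have hsecond := (convex_Icc 0 r).norm_image_sub_le_of_norm_hasDerivWithin_le
    (f := fun ρ : ℝ => G f ρ - (ρ : ℂ) * G (eulerAdd c f) 0)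
    (fun x _ => ((hG f x).sub ((Complex.ofRealCLM.hasDerivAt (x := x)).mul_const _)
      ).hasDerivWithinAt) (by simpa using hfirst) h0 (⟨hr, le_rfl⟩ : r ∈ Set.Icc 0 r)
  rw [sub_zero, Real.norm_of_nonneg hr] at hsecond
  calc |t| ^ k * ‖dilationRemainder c r f t‖ = ‖w * dilationRemainder c r f t‖ := by
        rw [norm_mul, hw]
    _ ≤ M * r * r := by
        refine le_of_eq_of_le (congrArg norm ?_) hsecond
        simp only [dilationRemainder, G, sub_apply, smul_apply, dilation_apply, smul_eq_mul,
          mul_zero, Real.exp_zero, Complex.ofReal_one, Complex.ofReal_zero, one_mul, zero_mul]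
        ring
    _ = M * r ^ 2 := by ring

theorem exists_seminorm_dilationRemainder_le (k n : ℕ) : ∀ (c : ℝ) (f : 𝓢(ℝ, ℂ)),
    ∃ C, 0 ≤ C ∧ ∀ r : ℝ, 0 ≤ r → r ≤ 1 →
      SchwartzMap.seminorm ℂ k n (dilationRemainder c r f) ≤ C * r ^ 2 := by
  induction n with
  | zero =>
    intro c f
    have hC : 0 ≤ Real.exp |c| * SchwartzMap.seminorm ℂ k 0 (eulerAdd c (eulerAdd c f)) := by
      positivity
    refine ⟨_, hC, fun r hr hr1 => seminorm_le_bound' ℂ k 0 _ (mul_nonneg hC (sq_nonneg r))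
      fun t => ?_⟩
    rw [iteratedDeriv_zero]
    exact norm_pow_mul_dilationRemainder_le k c f hr hr1 t
  | succ n ih =>
    intro c f
    obtain ⟨C, hC, h⟩ := ih (c + 1) (derivCLM ℂ ℂ f)
    refine ⟨C, hC, fun r hr hr1 => (seminorm_succ_le _ k n).trans ?_⟩
    rw [derivCLM_dilationRemainder]
    exact h r hr hr1

theorem tendsto_inv_smul_dilationRemainder (c : ℝ) (f : 𝓢(ℝ, ℂ)) :
    Tendsto (fun r : ℝ => ((r : ℂ)⁻¹) • dilationRemainder c r f) (𝓝[>] 0) (𝓝 0) := by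
  rw [(schwartz_withSeminorms ℂ ℝ ℂ).tendsto_nhds]
  rintro ⟨k, n⟩ ε hε
  obtain ⟨C, hC, h⟩ := exists_seminorm_dilationRemainder_le k n c f
  have hlim : Tendsto (fun r : ℝ => C * r) (𝓝[>] 0) (𝓝 0) := by
    have : Tendsto (fun r : ℝ => C * r) (𝓝 0) (𝓝 (C * 0)) := (continuous_const_mul C).tendsto 0
    rw [mul_zero] at this
    exact this.mono_left nhdsWithin_le_nhds
  filter_upwards [hlim.eventually_lt_const hε, Ioo_mem_nhdsGT (zero_lt_one' ℝ)] with r hr hr1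
  refine lt_of_le_of_lt ?_ hr
  rw [sub_zero, schwartzSeminormFamily_apply, map_smul_eq_mul, norm_inv, Complex.norm_real,
    Real.norm_of_nonneg hr1.1.le]
  calc r⁻¹ * _ ≤ r⁻¹ * (C * r ^ 2) := by
        gcongr
        · exact inv_nonneg.2 hr1.1.le
        · exact h r hr1.1.le hr1.2.le
    _ = C * r := by field_simp [hr1.1.ne']

/-- Euler's identity for homogeneous tempered distributions on the line. -/
theorem euler_of_dilation {ℓ : 𝓢(ℝ, ℂ) →L[ℂ] ℂ} {m : ℕ}
    (hℓ : ∀ (r : ℝ) (f : 𝓢(ℝ, ℂ)), ℓ (dilation r f) = (Real.exp (m * r) : ℂ) * ℓ f)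
    (f : 𝓢(ℝ, ℂ)) : ℓ (euler f) = m * ℓ f := by
  have h1 : Tendsto (fun r : ℝ => ℓ (((r : ℂ)⁻¹) • dilationRemainder 0 r f)) (𝓝[>] 0) (𝓝 0) := by
    have h := (ℓ.continuous.tendsto 0).comp (tendsto_inv_smul_dilationRemainder 0 f)
    rwa [map_zero] at h
  have hd : HasDerivAt (fun r : ℝ => (Real.exp (m * r) : ℂ)) (m : ℝ) 0 :=
    (((hasDerivAt_id (0 : ℝ)).const_mul (m : ℝ)).exp.congr_deriv (by simp)).ofReal_comp
  have h2 : Tendsto (fun r : ℝ => (r : ℂ)⁻¹ * (Real.exp (m * r) - 1) * ℓ f - ℓ (euler f))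
      (𝓝[>] 0) (𝓝 (m * ℓ f - ℓ (euler f))) := by
    have := hd.tendsto_slope_zero_right
    simp only [zero_add, mul_zero, Real.exp_zero, Complex.ofReal_one] at this
    refine ((this.mul_const (ℓ f)).sub_const (ℓ (euler f))).congr fun r => ?_
    rw [Complex.real_smul, Complex.ofReal_inv]
  have h3 := tendsto_nhds_unique (h2.congr' ?_) h1
  · exact (sub_eq_zero.1 h3).symm
  · filter_upwards [self_mem_nhdsWithin] with r hr
    have hr0 : (r : ℂ) ≠ 0 := by exact_mod_cast (ne_of_gt hr : r ≠ 0)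
    simp only [dilationRemainder, eulerAdd, map_smul, map_sub, hℓ, smul_eq_mul,
      add_apply, smul_apply, map_add,
      ContinuousLinearMap.id_apply]
    field_simp
    simp
    ring

section Tensor

variable {E F : Type*} [NormedAddCommGroup E] [NormedSpace ℝ E]
  [NormedAddCommGroup F] [NormedSpace ℝ F]

theorem norm_iteratedFDeriv_comp_le_of_norm_le_one {f : F → ℂ} (hf : ContDiff ℝ (⊤ : ℕ∞) f)
    (L : E →L[ℝ] F) (hL : ‖L‖ ≤ 1) (n : ℕ) (x : E) :
    ‖iteratedFDeriv ℝ n (fun y => f (L y)) x‖ ≤ ‖iteratedFDeriv ℝ n f (L x)‖ := by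
  change ‖iteratedFDeriv ℝ n (f ∘ L) x‖ ≤ _
  rw [L.iteratedFDeriv_comp_right hf x (mod_cast le_top)]
  refine (ContinuousMultilinearMap.norm_compContinuousLinearMap_le _ _).trans ?_
  refine mul_le_of_le_one_right (norm_nonneg _) ?_
  exact Finset.prod_le_one (fun _ _ => norm_nonneg _) fun _ _ => hL

theorem norm_pow_mul_iteratedFDeriv_tensor_le (φ : 𝓢(E, ℂ)) (ψ : 𝓢(F, ℂ)) (k n : ℕ)
    (x : E × F) :
    ‖x‖ ^ k * ‖iteratedFDeriv ℝ n (fun y : E × F => φ y.1 * ψ y.2) x‖ ≤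
      ∑ i ∈ Finset.range (n + 1), (n.choose i : ℝ) *
        (SchwartzMap.seminorm ℂ k i φ * SchwartzMap.seminorm ℂ 0 (n - i) ψ +
          SchwartzMap.seminorm ℂ 0 i φ * SchwartzMap.seminorm ℂ k (n - i) ψ) := by
  have hφ : ContDiff ℝ (⊤ : ℕ∞) (fun y : E × F => φ y.1) := (φ.smooth _).comp contDiff_fst
  have hψ : ContDiff ℝ (⊤ : ℕ∞) (fun y : E × F => ψ y.2) := (ψ.smooth _).comp contDiff_snd
  calc _ ≤ ‖x‖ ^ k * ∑ i ∈ Finset.range (n + 1), (n.choose i : ℝ) *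
          ‖iteratedFDeriv ℝ i (fun y : E × F => φ y.1) x‖ *
          ‖iteratedFDeriv ℝ (n - i) (fun y : E × F => ψ y.2) x‖ := by
        gcongr
        exact norm_iteratedFDeriv_mul_le hφ hψ x (mod_cast le_top)
    _ ≤ ∑ i ∈ Finset.range (n + 1), (n.choose i : ℝ) *
        ((‖x.1‖ ^ k + ‖x.2‖ ^ k) * (‖iteratedFDeriv ℝ i φ x.1‖ *
          ‖iteratedFDeriv ℝ (n - i) ψ x.2‖)) := by
        rw [Finset.mul_sum]
        refine Finset.sum_le_sum fun i _ => ?_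
        have h1 : ‖x‖ ^ k ≤ ‖x.1‖ ^ k + ‖x.2‖ ^ k := by
          rw [Prod.norm_def]
          rcases max_cases ‖x.1‖ ‖x.2‖ with ⟨h, _⟩ | ⟨h, _⟩ <;> rw [h]
          · exact le_add_of_nonneg_right (by positivity)
          · exact le_add_of_nonneg_left (by positivity)
        have h2 := norm_iteratedFDeriv_comp_le_of_norm_le_one (φ.smooth _)
          (ContinuousLinearMap.fst ℝ E F) (ContinuousLinearMap.norm_fst_le ..) i x
        have h3 := norm_iteratedFDeriv_comp_le_of_norm_le_one (ψ.smooth _)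
          (ContinuousLinearMap.snd ℝ E F) (ContinuousLinearMap.norm_snd_le ..) (n - i) x
        simp only [ContinuousLinearMap.coe_fst', ContinuousLinearMap.coe_snd'] at h2 h3
        rw [mul_assoc (n.choose i : ℝ), mul_left_comm]
        gcongr
    _ ≤ _ := by
        refine Finset.sum_le_sum fun i _ => ?_
        gcongr
        have h1 := le_seminorm ℂ k i φ x.1
        have h2 := le_seminorm ℂ 0 (n - i) ψ x.2
        have h3 := le_seminorm ℂ 0 i φ x.1
        have h4 := le_seminorm ℂ k (n - i) ψ x.2
        rw [pow_zero, one_mul] at h2 h3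
        calc _ = (‖x.1‖ ^ k * ‖iteratedFDeriv ℝ i φ x.1‖) * ‖iteratedFDeriv ℝ (n - i) ψ x.2‖ +
              ‖iteratedFDeriv ℝ i φ x.1‖ *
                (‖x.2‖ ^ k * ‖iteratedFDeriv ℝ (n - i) ψ x.2‖) := by ring
          _ ≤ _ := by gcongr

/-- The exterior product `φ ↦ φ ⊗ ψ` with a fixed Schwartz function `ψ`. -/
noncomputable def tensorRight (ψ : 𝓢(F, ℂ)) : 𝓢(E, ℂ) →L[ℂ] 𝓢(E × F, ℂ) :=
  mkCLM (fun φ y => φ y.1 * ψ y.2) (fun φ φ' y => by simp [add_mul])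
    (fun a φ y => by simp [mul_assoc])
    (fun φ => ((φ.smooth _).comp contDiff_fst).mul ((ψ.smooth _).comp contDiff_snd))
    (by
      rintro ⟨k, n⟩
      refine ⟨Finset.Iic (k, n), ∑ i ∈ Finset.range (n + 1), (n.choose i : ℝ) *
        (SchwartzMap.seminorm ℂ 0 (n - i) ψ + SchwartzMap.seminorm ℂ k (n - i) ψ), ?_,
        fun φ x => (norm_pow_mul_iteratedFDeriv_tensor_le φ ψ k n x).trans ?_⟩
      · exact Finset.sum_nonneg fun i _ => by positivity
      · rw [Finset.sum_mul]
        refine Finset.sum_le_sum fun i hi => ?_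
        have hsup : ∀ j ≤ k, SchwartzMap.seminorm ℂ j i φ ≤
            (Finset.Iic (k, n)).sup (schwartzSeminormFamily ℂ E ℂ) φ := fun j hj =>
          Seminorm.le_def.1 (Finset.le_sup (f := schwartzSeminormFamily ℂ E ℂ) (b := (j, i))
            (Finset.mem_Iic.2 (Prod.mk_le_mk.2 ⟨hj, Finset.mem_range_succ_iff.1 hi⟩))) φ
        have h1 := hsup k le_rfl
        have h2 := hsup 0 k.zero_le
        calc _ ≤ (n.choose i : ℝ) *
              ((Finset.Iic (k, n)).sup (schwartzSeminormFamily ℂ E ℂ) φ *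
                SchwartzMap.seminorm ℂ 0 (n - i) ψ +
              (Finset.Iic (k, n)).sup (schwartzSeminormFamily ℂ E ℂ) φ *
                SchwartzMap.seminorm ℂ k (n - i) ψ) := by gcongr
          _ = _ := by ring)

@[simp]
theorem tensorRight_apply (ψ : 𝓢(F, ℂ)) (φ : 𝓢(E, ℂ)) (y : E × F) :
    tensorRight ψ φ y = φ y.1 * ψ y.2 := rfl

/-- The exterior product `ψ ↦ φ ⊗ ψ` with a fixed Schwartz function `φ`. -/
noncomputable def tensorLeft (φ : 𝓢(E, ℂ)) : 𝓢(F, ℂ) →L[ℂ] 𝓢(E × F, ℂ) :=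
  compCLMOfContinuousLinearEquiv ℂ (ContinuousLinearEquiv.prodComm ℝ E F) ∘L tensorRight φ

@[simp]
theorem tensorLeft_apply (φ : 𝓢(E, ℂ)) (ψ : 𝓢(F, ℂ)) (y : E × F) :
    tensorLeft φ ψ y = φ y.1 * ψ y.2 := by
  simp [tensorLeft, mul_comm]

end Tensor

theorem iterate_derivCLM_apply (n : ℕ) (f : 𝓢(ℝ, ℂ)) (t : ℝ) :
    (derivCLM ℂ ℂ)^[n] f t = iteratedDeriv n f t := by
  induction n generalizing f with
  | zero => simp
  | succ n ih =>
    rw [Function.iterate_succ_apply, ih, iteratedDeriv_succ']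
    rfl

theorem integrableOn_log_mul (f : 𝓢(ℝ, ℂ)) :
    IntegrableOn (fun t => (Real.log t : ℂ) * f t) (Set.Ioi 0) := by
  rw [← Set.Ioc_union_Ioi_eq_Ioi (zero_le_one' ℝ)]
  refine IntegrableOn.union ?_ ?_
  · have h : IntegrableOn (fun t => (Real.log t : ℂ)) (Set.Ioc 0 1) :=
      ((intervalIntegrable_iff_integrableOn_Ioc_of_le zero_le_one).1
        intervalIntegral.intervalIntegrable_log').ofReal
    exact h.mul_bdd (c := SchwartzMap.seminorm ℂ 0 0 f) f.continuous.aestronglyMeasurable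
      (Eventually.of_forall fun t => norm_le_seminorm ℂ f t)
  · refine Integrable.mono' (g := fun t => ‖t‖ ^ 1 * ‖f t‖)
      (f.integrable_pow_mul volume 1).integrableOn
      ((Complex.measurable_ofReal.comp Real.measurable_log).aestronglyMeasurable.mul
        f.continuous.aestronglyMeasurable) ?_
    refine (ae_restrict_iff' measurableSet_Ioi).2 (Eventually.of_forall fun t ht => ?_)
    have ht : 1 < t := ht
    rw [norm_mul, Complex.norm_real, pow_one]
    gcongr
    rw [Real.norm_of_nonneg (Real.log_nonneg ht.le), Real.norm_of_nonneg (by linarith)]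
    exact Real.log_le_self (by linarith)

/-- Integration by parts against the logarithm for a function divisible by the coordinate. -/
theorem integral_log_mul_derivCLM_mulId (h : 𝓢(ℝ, ℂ)) :
    ∫ t in Set.Ioi (0 : ℝ), (Real.log t : ℂ) * derivCLM ℂ ℂ (mulId h) t =
      -∫ t in Set.Ioi (0 : ℝ), h t := by
  have hinv : Set.EqOn (fun t : ℝ => (t⁻¹ : ℝ) * mulId h t) h (Set.Ioi 0) := fun t ht => by
    have : (t : ℂ) ≠ 0 := by exact_mod_cast (ne_of_gt ht : t ≠ 0)
    simp [this]
  have hbd : ∀ g : 𝓢(ℝ, ℂ), Tendsto (fun t : ℝ => (Real.log t : ℂ) * mulId g t) (𝓝[>] 0) (𝓝 0) := by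
    intro g
    have h1 : Tendsto (fun t : ℝ => ((Real.log t * t : ℝ) : ℂ) * g t) (𝓝[>] 0) (𝓝 0) := by
      have h2 : Tendsto (fun t : ℝ => Real.log t * t) (𝓝[>] 0) (𝓝 0) := by
        simpa using tendsto_log_mul_rpow_nhdsGT_zero zero_lt_one
      have h3 := (Complex.continuous_ofReal.tendsto 0).comp h2
      simpa using h3.mul ((g.continuous.tendsto 0).mono_left nhdsWithin_le_nhds)
    refine h1.congr fun t => ?_
    rw [mulId_apply]; push_cast; ring
  have hinf : Tendsto (fun t : ℝ => (Real.log t : ℂ) * mulId h t) atTop (𝓝 0) := by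
    have h1 : Tendsto (fun t : ℝ => mulId (mulId h) t) atTop (𝓝 0) :=
      (mulId (mulId h)).tendsto_cocompact.mono_left _root_.atTop_le_cocompact
    refine squeeze_zero_norm' ?_ (tendsto_zero_iff_norm_tendsto_zero.1 h1)
    filter_upwards [eventually_ge_atTop 1] with t ht
    rw [mulId_apply (mulId h), norm_mul, norm_mul, Complex.norm_real, Complex.norm_real]
    gcongr
    rw [Real.norm_of_nonneg (Real.log_nonneg ht), Real.norm_of_nonneg (by linarith)]
    exact Real.log_le_self (by linarith)
  have hpart := integral_Ioi_mul_deriv_eq_deriv_mul (a := 0)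
    (u := fun t : ℝ => (Real.log t : ℂ)) (u' := fun t : ℝ => ((t⁻¹ : ℝ) : ℂ))
    (v := mulId h) (v' := derivCLM ℂ ℂ (mulId h))
    (fun t ht => (Real.hasDerivAt_log (ne_of_gt ht)).ofReal_comp)
    (fun t _ => (mulId h).hasDerivAt t) (integrableOn_log_mul _)
    ((integrableOn_congr_fun hinv measurableSet_Ioi).2 h.integrable.integrableOn)
    (hbd h) hinf
  rw [hpart, setIntegral_congr_fun measurableSet_Ioi hinv]
  simp

/-- The reflection `f ↦ f (-·)`. -/
noncomputable def reflection : 𝓢(ℝ, ℂ) →L[ℂ] 𝓢(ℝ, ℂ) :=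
  compCLMOfContinuousLinearEquiv ℂ (ContinuousLinearEquiv.neg ℝ)

@[simp]
theorem reflection_apply (f : 𝓢(ℝ, ℂ)) (t : ℝ) : reflection f t = f (-t) := by
  simp [reflection]

end SchwartzMap

open SchwartzMap

/-- `Tlog` as a linear functional on Schwartz functions. -/
noncomputable def TlogLM (m : ℕ) : 𝓢(ℝ, ℂ) →ₗ[ℂ] ℂ where
  toFun ψ := ∫ t in Set.Ioi (0 : ℝ), (Real.log t : ℂ) * (derivCLM ℂ ℂ ^ (m + 1)) ψ t
  map_add' f g := by
    simp only [map_add, add_apply, mul_add]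
    exact integral_add (integrableOn_log_mul _) (integrableOn_log_mul _)
  map_smul' c f := by
    simp only [map_smul, smul_apply, smul_eq_mul, mul_left_comm _ c, RingHom.id_apply]
    exact integral_const_mul _ _

theorem derivCLM_pow_apply (n : ℕ) (f : 𝓢(ℝ, ℂ)) (t : ℝ) :
    (derivCLM ℂ ℂ ^ n) f t = iteratedDeriv n f t := by
  rw [FunLike.coe_pow_eq_iterate, iterate_derivCLM_apply]

theorem TlogLM_apply (m : ℕ) (ψ : 𝓢(ℝ, ℂ)) : TlogLM m ψ = Tlog m ψ := by
  simp only [TlogLM, Tlog, LinearMap.coe_mk, AddHom.coe_mk, derivCLM_pow_apply]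

/-- The even or odd combination of `Tlog` that is homogeneous. -/
noncomputable def TlogSym (m : ℕ) : 𝓢(ℝ, ℂ) →ₗ[ℂ] ℂ :=
  TlogLM m + (-1 : ℂ) ^ (m + 1) • (TlogLM m ∘ₗ reflection.toLinearMap)

theorem TlogSym_apply (m : ℕ) (ψ : 𝓢(ℝ, ℂ)) :
    TlogSym m ψ = Tlog m (fun t => ψ t) + (-1 : ℂ) ^ (m + 1) * Tlog m (fun t => ψ (-t)) := by
  have h : ⇑(reflection ψ) = fun t => ψ (-t) := funext fun t => reflection_apply ψ t
  simp [TlogSym, TlogLM_apply, h]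

theorem TlogSym_eq_neg_integral {m : ℕ} {ψ h : 𝓢(ℝ, ℂ)}
    (hψ : (derivCLM ℂ ℂ)^[m] ψ = mulId h) : TlogSym m ψ = -∫ t, h t := by
  have hd : ∀ t, iteratedDeriv (m + 1) ψ t = derivCLM ℂ ℂ (mulId h) t := fun t => by
    rw [← hψ, ← Function.iterate_succ_apply' (derivCLM ℂ ℂ), iterate_derivCLM_apply]
  have hr : derivCLM ℂ ℂ (mulId (reflection h)) = reflection (derivCLM ℂ ℂ (mulId h)) := by
    rw [derivCLM_mulId, derivCLM_mulId]
    ext t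
    simp [show ⇑(reflection h) = fun t => h (-t) from funext fun t => reflection_apply h t,
      deriv_comp_neg]
  have h1 : Tlog m (fun t => ψ t) = -∫ t in Set.Ioi (0 : ℝ), h t := by
    rw [← integral_log_mul_derivCLM_mulId]
    simp only [Tlog, ← hd]
  have h2 : (-1 : ℂ) ^ (m + 1) * Tlog m (fun t => ψ (-t)) =
      -∫ t in Set.Iic (0 : ℝ), h t := by
    have h3 : ∫ t in Set.Iic (0 : ℝ), h t = ∫ t in Set.Ioi (0 : ℝ), reflection h t := by
      simp only [reflection_apply]
      rw [integral_comp_neg_Ioi, neg_zero]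
    rw [h3, ← integral_log_mul_derivCLM_mulId, hr, Tlog, ← integral_const_mul]
    congr 1 with t
    rw [reflection_apply, ← hd, iteratedDeriv_comp_neg, Complex.real_smul]
    push_cast
    rw [mul_left_comm, ← mul_assoc ((-1 : ℂ) ^ (m + 1)), ← mul_pow]
    simp
  rw [TlogSym_apply, h1, h2, ← intervalIntegral.integral_Iic_add_Ioi (μ := volume) (b := 0)
    h.integrable.integrableOn h.integrable.integrableOn]
  ring

/-- A homogeneous tempered distribution on the line vanishes on every test function annihilated by
both model homogeneous distributions. -/
theorem eq_zero_of_dilation {ℓ : 𝓢(ℝ, ℂ) →L[ℂ] ℂ} {m : ℕ}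
    (hℓ : ∀ (r : ℝ) (f : 𝓢(ℝ, ℂ)), ℓ (dilation r f) = (Real.exp (m * r) : ℂ) * ℓ f)
    {ψ : 𝓢(ℝ, ℂ)} (hT : TlogSym m ψ = 0) (hδ : (derivCLM ℂ ℂ)^[m] ψ 0 = 0) : ℓ ψ = 0 := by
  obtain ⟨h, hh⟩ := exists_mulId_eq _ hδ
  rw [TlogSym_eq_neg_integral hh.symm, neg_eq_zero] at hT
  obtain ⟨η, rfl⟩ := exists_euler_sub_eq m ψ h hh.symm hT
  rw [map_sub, map_smul, euler_of_dilation hℓ, smul_eq_mul, sub_self]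

/-- A linear map over a field has a generalized inverse. -/
theorem LinearMap.exists_generalizedInverse {K V W : Type*} [Field K] [AddCommGroup V]
    [Module K V] [AddCommGroup W] [Module K W] (L : V →ₗ[K] W) :
    ∃ σ : W →ₗ[K] V, ∀ x, L (σ (L x)) = L x := by
  obtain ⟨τ, hτ⟩ := L.rangeRestrict.exists_rightInverse_of_surjective L.range_rangeRestrict
  obtain ⟨σ, hσ⟩ := τ.exists_extend
  refine ⟨σ, fun x => ?_⟩
  have h1 : σ (L x) = τ (L.rangeRestrict x) := LinearMap.congr_fun hσ (L.rangeRestrict x)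
  rw [h1]
  exact congrArg Subtype.val (LinearMap.congr_fun hτ (L.rangeRestrict x))

/-- If `u` is a tempered distribution on `ℝ^{m'} × ℝ` homogeneous of degree `−m`
for the dilation action in the last variable, then there exist tempered distributions `v, v₀`
on `ℝ^{m'}` with `u(φ ⊗ ψ) = v(φ)·(T(ψ) + (−1)^{m+1}·T(ψ̌)) + v₀(φ)·ψ^{(m)}(0)` for all
Schwartz `φ, ψ`, where `ψ̌(t) = ψ(−t)`. -/
theorem stmt_4 (m' m : ℕ)
    (u : SchwartzMap ((Fin m' → ℝ) × ℝ) ℂ →L[ℂ] ℂ)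
    (hhom : ∀ s : ℝ, 0 < s → ∀ Φ Ψ : SchwartzMap ((Fin m' → ℝ) × ℝ) ℂ,
      (∀ (p : Fin m' → ℝ) (t : ℝ), Ψ (p, t) = Φ (p, s⁻¹ * t)) →
      u Ψ = (s : ℂ) ^ (-(m : ℂ)) * u Φ) :
    ∃ v v₀ : SchwartzMap (Fin m' → ℝ) ℂ →L[ℂ] ℂ,
      ∀ (φ : SchwartzMap (Fin m' → ℝ) ℂ) (ψ : SchwartzMap ℝ ℂ)
        (Φ : SchwartzMap ((Fin m' → ℝ) × ℝ) ℂ),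
        (∀ (p : Fin m' → ℝ) (t : ℝ), Φ (p, t) = φ p * ψ t) →
        u Φ = v φ * (Tlog m (fun t => ψ t) + (-1 : ℂ) ^ (m + 1) * Tlog m (fun t => ψ (-t)))
            + v₀ φ * iteratedDeriv m (fun t => ψ t) 0 := by
  let δ : 𝓢(ℝ, ℂ) →ₗ[ℂ] ℂ :=
    { toFun := fun ψ => (derivCLM ℂ ℂ ^ m) ψ 0
      map_add' := fun f g => by rw [map_add, add_apply]
      map_smul' := fun c f => by rw [map_smul, smul_apply, RingHom.id_apply] }
  have hδ : ∀ ψ, δ ψ = iteratedDeriv m ψ 0 := fun ψ => derivCLM_pow_apply m ψ 0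
  obtain ⟨σ, hσ⟩ := ((TlogSym m).prod δ).exists_generalizedInverse
  refine ⟨u ∘L tensorRight (σ (1, 0)), u ∘L tensorRight (σ (0, 1)), fun φ ψ Φ hΦ => ?_⟩
  have hΦ' : Φ = tensorLeft φ ψ := by ext ⟨p, t⟩; simp [hΦ]
  have hswap : ∀ χ : 𝓢(ℝ, ℂ), tensorRight χ φ = tensorLeft φ χ := fun χ => by ext y; simp
  let ℓ : 𝓢(ℝ, ℂ) →L[ℂ] ℂ := u ∘L tensorLeft φ
  have hℓ : ∀ (r : ℝ) (f : 𝓢(ℝ, ℂ)),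
      ℓ (dilation r f) = (Real.exp (m * r) : ℂ) * ℓ f := by
    intro r f
    have hpow : ((Real.exp (-r) : ℝ) : ℂ) ^ (-(m : ℂ)) = (Real.exp (m * r) : ℂ) := by
      rw [Complex.cpow_neg, Complex.cpow_natCast, ← Complex.ofReal_pow, ← Complex.ofReal_inv,
        ← Real.exp_nat_mul, ← Real.exp_neg, mul_neg, neg_neg]
    rw [← hpow]
    refine hhom _ (Real.exp_pos _) _ _ fun p t => ?_
    change tensorLeft φ (dilation r f) (p, t) = tensorLeft φ f (p, (Real.exp (-r))⁻¹ * t)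
    rw [tensorLeft_apply, tensorLeft_apply, dilation_apply, Real.exp_neg, inv_inv]
  have hker : TlogSym m (σ (TlogSym m ψ, δ ψ)) = TlogSym m ψ ∧ δ (σ (TlogSym m ψ, δ ψ)) = δ ψ :=
    Prod.mk.inj (hσ ψ)
  have hzero : ℓ (ψ - σ (TlogSym m ψ, δ ψ)) = 0 := by
    refine eq_zero_of_dilation hℓ ?_ ?_
    · rw [map_sub, hker.1, sub_self]
    · rw [iterate_derivCLM_apply, ← hδ, map_sub, hker.2, sub_self]
  have hsplit : σ (TlogSym m ψ, δ ψ) = TlogSym m ψ • σ (1, 0) + δ ψ • σ (0, 1) := by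
    rw [← map_smul, ← map_smul, ← map_add]; simp
  rw [map_sub, sub_eq_zero, hsplit, map_add, map_smul, map_smul] at hzero
  rw [hΦ', ← TlogSym_apply, ← hδ, ContinuousLinearMap.comp_apply, ContinuousLinearMap.comp_apply,
    hswap, hswap, mul_comm (u _), mul_comm (u _)]
  exact hzero
end

section
/- Let a ∈ ℕ with a ≥ 1, and let γ₊, γ₋ : ℝ^p × ℝ^n → ℂ be infinitely differentiable functions such that: (i) for every x and every j ∈ ℕ with j ≤ a − 1, the j-th iterated derivatives at 0 of Y ↦ γ₊(x, Y) and of Y ↦ γ₋(x, Y) both vanish; (ii) for every x, every j ≥ a, and every X ∈ ℝ^n, D_Y^j γ₊(x, 0)[X, …, X] = (−1)^{j−a} · D_Y^j γ₋(x, 0)[X, …, X]. Define F : ℝ^p × ℝ^n × ℝ → ℂ by F(x, X, t) = t^(−a)·γ₊(x, tX) for t > 0, F(x, X, t) = (−t)^(−a)·γ₋(x, −tX) for t < 0, and F(x, X, 0) = (1/a!)·D_Y^a γ₊(x, 0)[X, …, X]. Then F is infinitely differentiable on ℝ^p × ℝ^n × ℝ and homogeneous of degree a for the zoom action: F(x,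 sX, s⁻¹t) = s^a F(x, X, t) for all s > 0. -/
open scoped ContDiff Topology
open Set Filter

section ParametricIntegral

universe u

variable {E : Type u} [NormedAddCommGroup E] [NormedSpace ℝ E] [ProperSpace E]

theorem hasFDerivAt_parametric_intervalIntegral_of_contDiff {V : Type*} [NormedAddCommGroup V]
    [NormedSpace ℝ V] {f : E × ℝ → V} (hf : ContDiff ℝ 1 f) (x₀ : E) (a b : ℝ) :
    HasFDerivAt (fun x => ∫ s in a..b, f (x, s))
      (∫ s in a..b, (fderiv ℝ f (x₀, s)).comp (ContinuousLinearMap.inl ℝ E ℝ)) x₀ := by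
  have hcont : Continuous fun q : E × ℝ =>
      (fderiv ℝ f q).comp (ContinuousLinearMap.inl ℝ E ℝ) :=
    (hf.continuous_fderiv one_ne_zero).clm_comp continuous_const
  obtain ⟨C, hC⟩ := ((isCompact_closedBall x₀ 1).prod (isCompact_uIcc (a := a) (b := b))
    ).exists_bound_of_continuousOn hcont.continuousOn
  have hslice (x : E) : Continuous fun s : ℝ => f (x, s) :=
    hf.continuous.comp (Continuous.prodMk_right x)
  refine intervalIntegral.hasFDerivAt_integral_of_dominated_of_fderiv_le
    (F := fun x s => f (x, s)) (bound := fun _ => C)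
    (F' := fun x s => (fderiv ℝ f (x, s)).comp (ContinuousLinearMap.inl ℝ E ℝ))
    (Metric.closedBall_mem_nhds x₀ one_pos) ?_ ?_ ?_ ?_ ?_ ?_
  · exact Eventually.of_forall fun x => (hslice x).aestronglyMeasurable
  · exact (hslice x₀).intervalIntegrable _ _
  · exact (hcont.comp (Continuous.prodMk_right x₀)).aestronglyMeasurable
  · exact Eventually.of_forall fun s hs x hx => hC (x, s) ⟨hx, uIoc_subset_uIcc hs⟩
  · exact intervalIntegrable_const
  · refine Eventually.of_forall fun s _ x _ => ?_
    exact ((hf.differentiable one_ne_zero) (x, s)).hasFDerivAt.comp x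
      (hasFDerivAt_prodMk_left x s)

theorem contDiff_parametric_intervalIntegral {V : Type u} [NormedAddCommGroup V]
    [NormedSpace ℝ V] {f : E × ℝ → V} (hf : ContDiff ℝ ∞ f) (a b : ℝ) :
    ContDiff ℝ ∞ fun x => ∫ s in a..b, f (x, s) := by
  refine contDiff_infty.2 fun m => ?_
  induction m generalizing V with
  | zero =>
    exact contDiff_zero.2 (intervalIntegral.continuous_parametric_intervalIntegral_of_continuous'
      (f := fun x s => f (x, s)) hf.continuous a b)
  | succ m ih =>
    refine contDiff_succ_iff_hasFDerivAt.2 ⟨_, ?_, fun x =>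
      hasFDerivAt_parametric_intervalIntegral_of_contDiff (hf.of_le (by simp)) x a b⟩
    exact ih ((contDiff_infty_iff_fderiv.1 hf).2.clm_comp contDiff_const)

end ParametricIntegral

section Division

universe u

variable {E V : Type u} [NormedAddCommGroup E] [NormedSpace ℝ E]
  [NormedAddCommGroup V] [NormedSpace ℝ V]

/-- The Hadamard lemma: a smooth function vanishing on `{t = 0}` is a smooth multiple of `t`. -/
theorem exists_contDiff_eq_smul [ProperSpace E] [CompleteSpace V] {g : E × ℝ → V}
    (hg : ContDiff ℝ ∞ g) (h0 : ∀ z, g (z, 0) = 0) :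
    ∃ H : E × ℝ → V, ContDiff ℝ ∞ H ∧ ∀ z t, g (z, t) = t • H (z, t) := by
  have hg' := (contDiff_infty_iff_fderiv.1 hg).2
  have hint : ContDiff ℝ ∞ fun q : (E × ℝ) × ℝ => fderiv ℝ g (q.1.1, q.2 * q.1.2) (0, 1) :=
    (hg'.comp (by fun_prop)).clm_apply contDiff_const
  refine ⟨fun q => ∫ s in (0 : ℝ)..1, fderiv ℝ g (q.1, s * q.2) (0, 1),
    contDiff_parametric_intervalIntegral hint 0 1, fun z t => ?_⟩
  have hder (s : ℝ) : HasDerivAt (fun s : ℝ => g (z, s * t))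
      (t • fderiv ℝ g (z, s * t) (0, 1)) s := by
    have h1 : HasDerivAt (fun s : ℝ => (z, s * t)) ((0 : E), t) s :=
      (hasDerivAt_const s z).prodMk (by simpa using (hasDerivAt_id s).mul_const t)
    have := ((hg.differentiable (by simp)) (z, s * t)).hasFDerivAt.comp_hasDerivAt s h1
    rwa [← map_smul, show t • ((0 : E), (1 : ℝ)) = (0, t) by simp]
  have hcont : Continuous fun s : ℝ => t • fderiv ℝ g (z, s * t) (0, 1) :=
    continuous_const.smul ((hg'.continuous.comp (by fun_prop)).clm_apply continuous_const)
  have := intervalIntegral.integral_eq_sub_of_hasDerivAt (fun s _ => hder s)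
    (hcont.intervalIntegrable 0 1)
  rw [intervalIntegral.integral_smul] at this
  simpa [h0] using this.symm

theorem iteratedDeriv_succ_smul_zero {φ : ℝ → V} (hφ : ContDiff ℝ ∞ φ) (k : ℕ) :
    iteratedDeriv (k + 1) (fun t => t • φ t) 0 = ((k : ℝ) + 1) • iteratedDeriv k φ 0 := by
  have key (t : ℝ) : iteratedDeriv (k + 1) (fun t => t • φ t) t
      = t • iteratedDeriv (k + 1) φ t + ((k : ℝ) + 1) • iteratedDeriv k φ t := by
    have hd (j : ℕ) (t : ℝ) : HasDerivAt (iteratedDeriv j φ) (iteratedDeriv (j + 1) φ t) t := by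
      rw [iteratedDeriv_succ]
      exact (hφ.differentiable_iteratedDeriv j (by exact_mod_cast ENat.natCast_lt_top j) t).hasDerivAt
    induction k generalizing t with
    | zero =>
      have := (hasDerivAt_id t).smul (hd 0 t)
      simp only [iteratedDeriv_zero] at this
      rw [zero_add, iteratedDeriv_one, iteratedDeriv_zero]
      exact this.deriv.trans (by simp [iteratedDeriv_one])
    | succ k ih =>
      rw [iteratedDeriv_succ, funext ih]
      have := ((hasDerivAt_id t).smul (hd (k + 1) t)).add ((hd k t).const_smul ((k : ℝ) + 1))
      refine this.deriv.trans ?_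
      simp only [id]
      push_cast
      module
  simpa using key 0

theorem exists_contDiff_eq_pow_smul [ProperSpace E] [CompleteSpace V] (k : ℕ) {g : E × ℝ → V}
    (hg : ContDiff ℝ ∞ g) (h0 : ∀ z, ∀ j < k, iteratedDeriv j (fun t => g (z, t)) 0 = 0) :
    ∃ H : E × ℝ → V, ContDiff ℝ ∞ H ∧ (∀ z t, g (z, t) = t ^ k • H (z, t)) ∧
      ∀ z, iteratedDeriv k (fun t => g (z, t)) 0 = (k.factorial : ℝ) • H (z, 0) := by
  induction k generalizing g with
  | zero => exact ⟨g, hg, by simp, by simp⟩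
  | succ k ih =>
    obtain ⟨H, hH, hgH⟩ := exists_contDiff_eq_smul hg
      (fun z => by simpa using h0 z 0 k.succ_pos)
    have hder (z : E) (j : ℕ) : iteratedDeriv (j + 1) (fun t => g (z, t)) 0
        = ((j : ℝ) + 1) • iteratedDeriv j (fun t => H (z, t)) 0 := by
      simp only [hgH]
      exact iteratedDeriv_succ_smul_zero (hH.comp (contDiff_prodMk_right z)) j
    obtain ⟨K, hK, hHK, hK0⟩ := ih hH fun z j hj => by
      have := h0 z (j + 1) (by lia)
      rw [hder] at this
      exact (smul_eq_zero.1 this).resolve_left (by positivity)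
    refine ⟨K, hK, fun z t => by rw [hgH, hHK, smul_smul, pow_succ'], fun z => ?_⟩
    rw [hder, hK0, smul_smul, Nat.factorial_succ]
    push_cast
    rfl

omit [NormedSpace ℝ E] in
theorem eq_of_pow_smul_eq {f g : E × ℝ → V} (hf : Continuous f) (hg : Continuous g) (k : ℕ)
    (h : ∀ z t, t ^ k • f (z, t) = t ^ k • g (z, t)) : f = g := by
  funext ⟨z, t⟩
  have hne : EqOn (fun t => f (z, t)) (fun t => g (z, t)) {0}ᶜ := fun t ht =>
    smul_right_injective V (pow_ne_zero k ht) (h z t)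
  exact congrFun (Continuous.ext_on (dense_compl_singleton (0 : ℝ))
    (hf.comp (Continuous.prodMk_right z)) (hg.comp (Continuous.prodMk_right z)) hne) t

end Division

section Gluing

universe u

variable {E V : Type u} [NormedAddCommGroup E] [NormedSpace ℝ E]
  [NormedAddCommGroup V] [NormedSpace ℝ V]

/-- A smooth function on `E × ℝ` that is divisible by all powers of the last coordinate. -/
def FlatAtZero (D : E × ℝ → V) : Prop :=
  ContDiff ℝ ∞ D ∧ ∀ k : ℕ, ∃ H : E × ℝ → V, ContDiff ℝ ∞ H ∧ ∀ q, D q = q.2 ^ k • H q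

theorem FlatAtZero.fderiv {D : E × ℝ → V} (hD : FlatAtZero D) : FlatAtZero (fderiv ℝ D) := by
  refine ⟨(contDiff_infty_iff_fderiv.1 hD.1).2, fun k => ?_⟩
  obtain ⟨H, hH, hDH⟩ := hD.2 (k + 1)
  refine ⟨fun q => q.2 • _root_.fderiv ℝ H q +
    ((k : ℝ) + 1) • (ContinuousLinearMap.snd ℝ E ℝ).smulRight (H q), ?_, fun q => ?_⟩
  · refine (contDiff_snd.smul (contDiff_infty_iff_fderiv.1 hH).2).add ?_
    have hL : ContDiff ℝ ∞ fun q => (ContinuousLinearMap.snd ℝ E ℝ).smulRight (H q) :=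
      contDiff_const.smulRight hH
    exact hL.const_smul ((k : ℝ) + 1)
  · have h1 : HasFDerivAt (fun q : E × ℝ => q.2 ^ (k + 1))
        ((((k + 1 : ℕ) : ℝ) * q.2 ^ k) • ContinuousLinearMap.snd ℝ E ℝ) q := by
      simpa using (hasFDerivAt_snd (p := q) (𝕜 := ℝ)).pow (k + 1)
    have h2 := h1.smul ((hH.differentiable (by simp)) q).hasFDerivAt
    rw [funext hDH]
    refine h2.fderiv.trans ?_
    ext v <;> simp [smul_smul] <;> module

theorem FlatAtZero.hasFDerivAt_ite {D : E × ℝ → V} (hD : FlatAtZero D) (q : E × ℝ) :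
    HasFDerivAt (fun q : E × ℝ => if 0 < q.2 then D q else 0)
      (if 0 < q.2 then _root_.fderiv ℝ D q else 0) q := by
  rcases lt_trichotomy q.2 0 with hq | hq | hq
  · rw [if_neg hq.not_gt]
    refine (hasFDerivAt_const (0 : V) q).congr_of_eventuallyEq ?_
    filter_upwards [continuous_snd.continuousAt.eventually_lt_const hq] with r hr
    exact if_neg hr.not_gt
  · rw [if_neg hq.not_gt]
    have hfd : _root_.fderiv ℝ D q = 0 := by
      obtain ⟨H, -, h⟩ := hD.fderiv.2 1
      simp [h, hq]
    have hDq : D q = 0 := by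
      obtain ⟨H, -, h⟩ := hD.2 1
      simp [h, hq]
    have h := ((hD.1.differentiable (by simp)) q).hasFDerivAt
    rw [hfd, hasFDerivAt_iff_isLittleO] at h
    rw [hasFDerivAt_iff_isLittleO]
    refine Asymptotics.IsBigO.trans_isLittleO (Asymptotics.isBigO_of_le _ fun r => ?_) h
    by_cases hr : 0 < r.2 <;> simp [hr, hq, hDq]
  · rw [if_pos hq]
    refine ((hD.1.differentiable (by simp)) q).hasFDerivAt.congr_of_eventuallyEq ?_
    filter_upwards [continuous_snd.continuousAt.eventually_const_lt hq] with r hr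
    exact if_pos hr

theorem FlatAtZero.contDiff_ite {D : E × ℝ → V} (hD : FlatAtZero D) :
    ContDiff ℝ ∞ fun q : E × ℝ => if 0 < q.2 then D q else 0 := by
  refine contDiff_infty.2 fun m => ?_
  induction m generalizing V with
  | zero =>
    exact contDiff_zero.2 (continuous_iff_continuousAt.2 fun q =>
      (hD.hasFDerivAt_ite q).continuousAt)
  | succ m ih => exact contDiff_succ_iff_hasFDerivAt.2 ⟨_, ih hD.fderiv, hD.hasFDerivAt_ite⟩

end Gluing

theorem iteratedDeriv_comp_smul_const {B V : Type*} [NormedAddCommGroup B] [NormedSpace ℝ B]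
    [NormedAddCommGroup V] [NormedSpace ℝ V] {f : B → V} (hf : ContDiff ℝ ∞ f) (j : ℕ) (X : B) :
    iteratedDeriv j (fun t : ℝ => f (t • X)) 0 = iteratedFDeriv ℝ j f 0 (fun _ => X) := by
  have h := (ContinuousLinearMap.toSpanSingleton ℝ X).iteratedFDeriv_comp_right hf 0
    (i := j) (by exact_mod_cast le_top)
  have h' := congrArg (fun m => m fun _ => (1 : ℝ)) h
  simpa [iteratedDeriv_eq_iteratedFDeriv, Function.comp_def,
    ContinuousLinearMap.toSpanSingleton_apply] using h'


/-- Converse gluing for positive integer degree `a ≥ 1`. If `γ₊, γ₋` are smooth,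
vanish to order `a − 1` on `{X = 0}` and satisfy the compatibility
`D^j γ₊(x,0)[X,…,X] = (−1)^{j−a} D^j γ₋(x,0)[X,…,X]` for `j ≥ a`, then
`F(x,X,t) = t^(−a)γ₊(x,tX)` for `t>0`, `(−t)^(−a)γ₋(x,−tX)` for `t<0`, and
`(1/a!)·D^a γ₊(x,0)[X,…,X]` at `t=0`, is smooth and homogeneous of degree `a` for
the zoom action. -/
theorem stmt_8 (p n : ℕ) (a : ℕ) (ha : 1 ≤ a)
    (γp γm : (Fin p → ℝ) × (Fin n → ℝ) → ℂ)
    (hγp : ContDiff ℝ (⊤ : ℕ∞) γp) (hγm : ContDiff ℝ (⊤ : ℕ∞) γm)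
    (hvanish : ∀ (x : Fin p → ℝ) (j : ℕ), j ≤ a - 1 →
      iteratedFDeriv ℝ j (fun Y : Fin n → ℝ => γp (x, Y)) 0 = 0 ∧
      iteratedFDeriv ℝ j (fun Y : Fin n → ℝ => γm (x, Y)) 0 = 0)
    (hcompat : ∀ (x : Fin p → ℝ) (j : ℕ), a ≤ j → ∀ X : Fin n → ℝ,
      iteratedFDeriv ℝ j (fun Y : Fin n → ℝ => γp (x, Y)) 0 (fun _ => X)
        = (-1 : ℂ) ^ (j - a) *
          iteratedFDeriv ℝ j (fun Y : Fin n → ℝ => γm (x, Y)) 0 (fun _ => X))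
    (F : (Fin p → ℝ) × (Fin n → ℝ) × ℝ → ℂ)
    (hFpos : ∀ (x : Fin p → ℝ) (X : Fin n → ℝ) (t : ℝ), 0 < t →
      F (x, X, t) = (t : ℂ) ^ (-(a : ℂ)) * γp (x, t • X))
    (hFneg : ∀ (x : Fin p → ℝ) (X : Fin n → ℝ) (t : ℝ), t < 0 →
      F (x, X, t) = ((-t : ℝ) : ℂ) ^ (-(a : ℂ)) * γm (x, (-t) • X))
    (hF0 : ∀ (x : Fin p → ℝ) (X : Fin n → ℝ),
      F (x, X, 0) = (1 / (a.factorial : ℂ)) *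
        iteratedFDeriv ℝ a (fun Y : Fin n → ℝ => γp (x, Y)) 0 (fun _ => X)) :
    ContDiff ℝ (⊤ : ℕ∞) F ∧
    ∀ s : ℝ, 0 < s → ∀ (x : Fin p → ℝ) (X : Fin n → ℝ) (t : ℝ),
      F (x, s • X, s⁻¹ * t) = (s : ℂ) ^ (a : ℂ) * F (x, X, t) := by
  have cpow_neg_nat (r : ℝ) : (r : ℂ) ^ (-(a : ℂ)) = ((r : ℂ) ^ a)⁻¹ := by
    rw [Complex.cpow_neg, Complex.cpow_natCast]
  constructor
  · let gp : ((Fin p → ℝ) × (Fin n → ℝ)) × ℝ → ℂ := fun q => γp (q.1.1, q.2 • q.1.2)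
    let gm : ((Fin p → ℝ) × (Fin n → ℝ)) × ℝ → ℂ := fun q => γm (q.1.1, q.2 • -q.1.2)
    have hgp : ContDiff ℝ ∞ gp := hγp.comp (by fun_prop)
    have hgm : ContDiff ℝ ∞ gm := hγm.comp (by fun_prop)
    have hdp (z : (Fin p → ℝ) × (Fin n → ℝ)) (j : ℕ) :
        iteratedDeriv j (fun t => gp (z, t)) 0
          = iteratedFDeriv ℝ j (fun Y : Fin n → ℝ => γp (z.1, Y)) 0 (fun _ => z.2) :=
      iteratedDeriv_comp_smul_const (f := fun Y => γp (z.1, Y))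
        (hγp.comp (contDiff_prodMk_right z.1)) j z.2
    have hdm (z : (Fin p → ℝ) × (Fin n → ℝ)) (j : ℕ) :
        iteratedDeriv j (fun t => gm (z, t)) 0 = (-1 : ℂ) ^ j *
          iteratedFDeriv ℝ j (fun Y : Fin n → ℝ => γm (z.1, Y)) 0 (fun _ => z.2) := by
      have h := iteratedDeriv_comp_smul_const (f := fun Y => γm (z.1, Y))
        (hγm.comp (contDiff_prodMk_right z.1)) j (-z.2)
      have h' := (iteratedFDeriv ℝ j (fun Y : Fin n → ℝ => γm (z.1, Y)) 0).map_smul_univ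
        (fun _ => (-1 : ℝ)) (fun _ => z.2)
      refine h.trans ?_
      simpa using h'
    obtain ⟨P, hP, hgP, hP0⟩ := exists_contDiff_eq_pow_smul a hgp fun z j hj => by
      rw [hdp, (hvanish z.1 j (by lia)).1]
      rfl
    obtain ⟨M, hM, hgM, -⟩ := exists_contDiff_eq_pow_smul a hgm fun z j hj => by
      rw [hdm, (hvanish z.1 j (by lia)).2]
      simp
    have hflat : FlatAtZero fun q => P q - (-1 : ℂ) ^ a * M q := by
      refine ⟨hP.sub (contDiff_const.mul hM), fun k => ?_⟩
      have hsub : ContDiff ℝ ∞ fun q => gp q - (-1 : ℂ) ^ a * gm q :=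
        hgp.sub (contDiff_const.mul hgm)
      obtain ⟨H, hH, hgH, -⟩ := exists_contDiff_eq_pow_smul (a + k) hsub fun z j _ => by
        have hcp : ContDiff ℝ j fun t => gp (z, t) :=
          (hgp.comp (contDiff_prodMk_right z)).of_le (by exact_mod_cast le_top)
        have hcm : ContDiff ℝ j fun t => gm (z, t) :=
          (hgm.comp (contDiff_prodMk_right z)).of_le (by exact_mod_cast le_top)
        rw [iteratedDeriv_fun_sub hcp.contDiffAt (contDiff_const.mul hcm).contDiffAt,
          iteratedDeriv_const_mul _ hcm.contDiffAt, hdp, hdm]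
        rcases Nat.lt_or_ge j a with hj | hj
        · rw [(hvanish z.1 j (by lia)).1, (hvanish z.1 j (by lia)).2]
          simp
        · obtain ⟨i, rfl⟩ := Nat.exists_eq_add_of_le hj
          have hs : ((-1 : ℂ) ^ a) * (-1) ^ a = 1 := by rw [← mul_pow]; simp
          rw [hcompat z.1 _ hj, Nat.add_sub_cancel_left, pow_add]
          linear_combination -(-1 : ℂ) ^ i *
            iteratedFDeriv ℝ (a + i) (fun Y => γm (z.1, Y)) 0 (fun _ => z.2) * hs
      refine ⟨H, hH, fun q => ?_⟩
      refine congrFun (eq_of_pow_smul_eq (hP.sub (contDiff_const.mul hM)).continuous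
        (g := fun q => q.2 ^ k • H q) ((continuous_snd.pow k).smul hH.continuous) a
        fun z t => ?_) q
      have h := hgH z t
      rw [hgP, hgM] at h
      simp only [Complex.real_smul, Complex.ofReal_pow] at h ⊢
      linear_combination h
    have hF : F = (fun q : ((Fin p → ℝ) × (Fin n → ℝ)) × ℝ =>
        (if 0 < q.2 then P q - (-1 : ℂ) ^ a * M q else 0) + (-1 : ℂ) ^ a * M q) ∘
        (fun q : (Fin p → ℝ) × (Fin n → ℝ) × ℝ => ((q.1, q.2.1), q.2.2)) := by
      funext ⟨x, X, t⟩
      have hp := hgP (x, X) t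
      have hm := hgM (x, X) t
      simp only [gp, gm, Complex.real_smul, Complex.ofReal_pow] at hp hm
      simp only [Function.comp_apply]
      rcases lt_trichotomy t 0 with ht | rfl | ht
      · have hne : (t : ℂ) ^ a ≠ 0 := pow_ne_zero _ (by exact_mod_cast ht.ne)
        rw [hFneg x X t ht, if_neg ht.not_gt, cpow_neg_nat, neg_smul, ← smul_neg, hm,
          Complex.ofReal_neg, neg_pow, mul_inv, ← inv_pow]
        field_simp
        norm_num
      · have h0 : P ((x, X), 0) - (-1 : ℂ) ^ a * M ((x, X), 0) = 0 := by
          obtain ⟨H, -, h⟩ := hflat.2 1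
          simpa using h ((x, X), 0)
        have h1 := hP0 (x, X)
        rw [hdp, Complex.real_smul] at h1
        have hfac : (a.factorial : ℂ) ≠ 0 := by exact_mod_cast a.factorial_ne_zero
        rw [hF0, h1, if_neg (lt_irrefl _), zero_add, ← sub_eq_zero.1 h0]
        push_cast
        field_simp
      · have hne : (t : ℂ) ^ a ≠ 0 := pow_ne_zero _ (by exact_mod_cast ht.ne')
        rw [hFpos x X t ht, if_pos ht, cpow_neg_nat, hp, sub_add_cancel]
        field_simp
    rw [hF]
    exact (hflat.contDiff_ite.add (contDiff_const.mul hM)).comp (by fun_prop)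
  · intro s hs x X t
    have hsc : (s : ℂ) ≠ 0 := by exact_mod_cast hs.ne'
    have hscale (r : ℝ) : (s⁻¹ * r) • s • X = r • X := by
      rw [smul_smul, mul_right_comm, inv_mul_cancel₀ hs.ne', one_mul]
    rw [Complex.cpow_natCast]
    rcases lt_trichotomy t 0 with ht | rfl | ht
    · rw [hFneg x X t ht, hFneg x _ _ (mul_neg_of_pos_of_neg (inv_pos.2 hs) ht), cpow_neg_nat,
        cpow_neg_nat, ← mul_neg, hscale, Complex.ofReal_mul, mul_pow, mul_inv, Complex.ofReal_inv,
        inv_pow, inv_inv, mul_assoc]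
    · rw [mul_zero, hF0, hF0]
      have h := (iteratedFDeriv ℝ a (fun Y : Fin n → ℝ => γp (x, Y)) 0).map_smul_univ
        (fun _ => s) (fun _ => X)
      simp only [Finset.prod_const, Finset.card_univ, Fintype.card_fin, Complex.real_smul,
        Complex.ofReal_pow] at h
      rw [h]
      ring
    · rw [hFpos x X t ht, hFpos x _ _ (mul_pos (inv_pos.2 hs) ht), cpow_neg_nat,
        cpow_neg_nat, hscale, Complex.ofReal_mul, mul_pow, mul_inv, Complex.ofReal_inv,
        inv_pow, inv_inv, mul_assoc]
end

section
/- Let a ∈ ℝ with −a ∉ ℕ (a is not a nonpositive integer). Let u be a tempered distribution on ℝ^n such that: (i) u(φ) = 0 for every Schwartz function φ that vanishes on some open neighborhood of the origin (u is supported at the origin); (ii) u is weakly homogeneous of degree a, i.e. for every Schwartz φ there exists C > 0 with |u(φ_s)| ≤ C·s^a for all s > 0, where φ_s(x) = φ(s⁻¹x). Then u = 0. In particular, a tempered distribution on ℝ^n weakly homogeneous of degree a with −a ∉ ℕ is uniquely determined by its values on Schwartz functions vanishing near the origin. -/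
open SchwartzMap Metric
open scoped ContDiff

/-- If the derivatives of `f` of order at most `N` vanish at the origin and those of order `N + 1`
are bounded, then the derivative of order `j ≤ N + 1` is `O(‖x‖ ^ (N + 1 - j))`. -/
theorem norm_iteratedFDeriv_le_of_iteratedFDeriv_zero {E F : Type*} [NormedAddCommGroup E]
    [NormedSpace ℝ E] [NormedAddCommGroup F] [NormedSpace ℝ F] {f : E → F} (hf : ContDiff ℝ ∞ f)
    {N : ℕ} (h0 : ∀ j ≤ N, iteratedFDeriv ℝ j f 0 = 0) {B : ℝ}
    (hB : ∀ x, ‖iteratedFDeriv ℝ (N + 1) f x‖ ≤ B) (k : ℕ) :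
    ∀ j, j + k = N + 1 → ∀ x, ‖iteratedFDeriv ℝ j f x‖ ≤ B * ‖x‖ ^ k := by
  have hB0 : 0 ≤ B := (norm_nonneg _).trans (hB 0)
  induction k with
  | zero =>
    intro j hj x
    obtain rfl : j = N + 1 := by omega
    simpa using hB x
  | succ k ih =>
    intro j hj x
    have hd : Differentiable ℝ (iteratedFDeriv ℝ j f) :=
      hf.differentiable_iteratedFDeriv (by exact_mod_cast WithTop.coe_lt_top _)
    have := (convex_closedBall (0 : E) ‖x‖).norm_image_sub_le_of_norm_fderiv_le
      (f := iteratedFDeriv ℝ j f) (C := B * ‖x‖ ^ k) (𝕜 := ℝ) (x := 0) (y := x)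
      (fun y _ ↦ hd y) (fun y hy ↦ ?_) (by simp) (by simp)
    · rwa [h0 j (by omega), sub_zero, sub_zero, mul_assoc, ← pow_succ] at this
    · rw [norm_fderiv_iteratedFDeriv]
      refine (ih (j + 1) (by omega) y).trans ?_
      have : ‖y‖ ≤ ‖x‖ := by simpa using hy
      gcongr

section Schwartz

variable {E : Type*} [NormedAddCommGroup E] [NormedSpace ℝ E]

/-- The dilation `φ ↦ (x ↦ φ (s⁻¹ x))` of Schwartz functions. -/
noncomputable def schwartzDilation (s : ℝˣ) : 𝓢(E, ℂ) →L[ℂ] 𝓢(E, ℂ) :=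
  compCLMOfContinuousLinearEquiv ℂ (ContinuousLinearEquiv.smulLeft s⁻¹)

theorem schwartzDilation_apply (s : ℝˣ) (φ : 𝓢(E, ℂ)) (x : E) :
    schwartzDilation s φ x = φ ((s : ℝ)⁻¹ • x) := by
  change φ (s⁻¹ • x) = _
  rw [Units.smul_def, Units.val_inv_eq_inv_val]

theorem iteratedFDeriv_schwartzDilation (s : ℝˣ) (φ : 𝓢(E, ℂ)) (j : ℕ) (x : E) :
    iteratedFDeriv ℝ j (schwartzDilation s φ) x =
      ((s : ℝ)⁻¹) ^ j • iteratedFDeriv ℝ j φ ((s : ℝ)⁻¹ • x) := by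
  have : (schwartzDilation s φ : E → ℂ) = fun x ↦ φ ((s : ℝ)⁻¹ • x) :=
    funext (schwartzDilation_apply s φ)
  rw [this, iteratedFDeriv_comp_const_smul _ (φ.smooth j)]

theorem seminorm_dilation_smul_le {χ ψ : 𝓢(E, ℂ)} (hχ : tsupport χ ⊆ closedBall 0 2) {N : ℕ}
    (h0 : ∀ j ≤ N, iteratedFDeriv ℝ j ψ 0 = 0) :
    ∃ K, 0 ≤ K ∧ ∀ s : ℝˣ, 0 < (s : ℝ) → (s : ℝ) ≤ 1 / 2 → ∀ k m : ℕ, m ≤ N →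
      SchwartzMap.seminorm ℂ k m (smulLeftCLM ℂ (schwartzDilation s χ) ψ) ≤ K * s := by
  obtain ⟨A, hA0, hAi⟩ : ∃ A : ℝ, 0 ≤ A ∧ ∀ i ≤ N, ∀ x, ‖iteratedFDeriv ℝ i χ x‖ ≤ A :=
    ⟨∑ i ∈ Finset.range (N + 1), SchwartzMap.seminorm ℂ 0 i χ,
      Finset.sum_nonneg fun _ _ ↦ apply_nonneg _ _, fun i hi x ↦
      (norm_iteratedFDeriv_le_seminorm ℂ χ i x).trans <|
        Finset.single_le_sum (f := fun i ↦ SchwartzMap.seminorm ℂ 0 i χ)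
          (fun _ _ ↦ apply_nonneg _ _) (Finset.mem_range.2 (by omega))⟩
  obtain ⟨B, hB0, hψ⟩ : ∃ B : ℝ, 0 ≤ B ∧ ∀ k j, j + k = N + 1 →
      ∀ x, ‖iteratedFDeriv ℝ j ψ x‖ ≤ B * ‖x‖ ^ k :=
    ⟨SchwartzMap.seminorm ℂ 0 (N + 1) ψ, apply_nonneg _ _,
      norm_iteratedFDeriv_le_of_iteratedFDeriv_zero (ψ.smooth ⊤) h0
        (norm_iteratedFDeriv_le_seminorm ℂ ψ (N + 1))⟩
  refine ⟨2 ^ N * (A * B * 2 ^ (N + 1)), by positivity, fun s hs hs' k m hm ↦ ?_⟩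
  refine seminorm_le_bound ℂ k m _ (by positivity) fun x ↦ ?_
  have hcoe : (smulLeftCLM ℂ (schwartzDilation s χ) ψ : E → ℂ) =
      fun x ↦ schwartzDilation s χ x • ψ x :=
    smulLeftCLM_apply (schwartzDilation s χ).hasTemperateGrowth ψ
  have hsum := norm_iteratedFDeriv_smul_le (𝕜 := ℝ) (N := m)
    ((schwartzDilation s χ).smooth m) (ψ.smooth m) x le_rfl
  rw [hcoe]
  have hterm : ∀ i ∈ Finset.range (m + 1),
      ‖x‖ ^ k * ((m.choose i : ℝ) * ‖iteratedFDeriv ℝ i (schwartzDilation s χ) x‖ *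
        ‖iteratedFDeriv ℝ (m - i) ψ x‖) ≤ m.choose i * (A * B * 2 ^ (N + 1) * s) := by
    intro i hi
    have hi : i ≤ m := by simpa [Nat.lt_succ_iff] using hi
    by_cases hx : ‖x‖ ≤ 2 * s
    · have h1 : ‖iteratedFDeriv ℝ i (schwartzDilation s χ) x‖ ≤ ((s : ℝ)⁻¹) ^ i * A := by
        rw [iteratedFDeriv_schwartzDilation, norm_smul, Real.norm_of_nonneg (by positivity)]
        gcongr
        exact hAi i (by omega) _
      have h2 : ‖iteratedFDeriv ℝ (m - i) ψ x‖ ≤ B * (2 * s) ^ (N + 1 - m + i) :=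
        (hψ (N + 1 - m + i) (m - i) (by omega) x).trans (by gcongr)
      have h3 : ‖x‖ ^ k ≤ 1 := pow_le_one₀ (norm_nonneg _) (by linarith)
      have h4 : ((s : ℝ)⁻¹) ^ i * (2 * s) ^ (N + 1 - m + i) ≤ 2 ^ (N + 1) * (s : ℝ) := by
        have e : ((s : ℝ)⁻¹) ^ i * (2 * s) ^ (N + 1 - m + i) =
            2 ^ (N + 1 - m + i) * (s : ℝ) ^ (N + 1 - m) := by
          rw [mul_pow, pow_add (s : ℝ), inv_pow]
          field_simp
        rw [e]
        gcongr ?_ * ?_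
        · exact pow_le_pow_right₀ one_le_two (by omega)
        · exact pow_le_of_le_one hs.le (by linarith) (by omega)
      calc _ ≤ 1 * ((m.choose i : ℝ) * (((s : ℝ)⁻¹) ^ i * A) *
            (B * (2 * s) ^ (N + 1 - m + i))) := by gcongr
        _ = m.choose i * (A * B) * (((s : ℝ)⁻¹) ^ i * (2 * s) ^ (N + 1 - m + i)) := by ring
        _ ≤ m.choose i * (A * B) * (2 ^ (N + 1) * (s : ℝ)) := by gcongr
        _ = _ := by ring
    · have h1 : iteratedFDeriv ℝ i (schwartzDilation s χ) x = 0 := by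
        rw [iteratedFDeriv_schwartzDilation]
        have : iteratedFDeriv ℝ i χ ((s : ℝ)⁻¹ • x) = 0 := by
          by_contra hne
          have := hχ (support_iteratedFDeriv_subset i hne)
          rw [mem_closedBall_zero_iff, norm_smul, Real.norm_of_nonneg (by positivity),
            inv_mul_le_iff₀ hs] at this
          exact hx (by linarith)
        rw [this, smul_zero]
      simp only [h1, norm_zero, mul_zero, zero_mul]
      positivity
  calc _ ≤ ‖x‖ ^ k * ∑ i ∈ Finset.range (m + 1), ((m.choose i : ℝ) *
        ‖iteratedFDeriv ℝ i (schwartzDilation s χ) x‖ * ‖iteratedFDeriv ℝ (m - i) ψ x‖) := by gcongr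
    _ ≤ ∑ i ∈ Finset.range (m + 1), m.choose i * (A * B * 2 ^ (N + 1) * s) := by
      rw [Finset.mul_sum]
      exact Finset.sum_le_sum hterm
    _ = 2 ^ m * (A * B * 2 ^ (N + 1) * s) := by
      rw [← Finset.sum_mul]
      congr 1
      exact_mod_cast Nat.sum_range_choose m
    _ ≤ 2 ^ N * (A * B * 2 ^ (N + 1) * s) := by
      gcongr
      norm_num
    _ = _ := by ring

/-- A tempered distribution supported at the origin has finite order there: it kills every
Schwartz function vanishing at the origin to a sufficiently high order. -/
theorem exists_order_of_support_zero [FiniteDimensional ℝ E] (u : 𝓢(E, ℂ) →L[ℂ] ℂ)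
    (hu : ∀ φ : 𝓢(E, ℂ), (∃ U : Set E, IsOpen U ∧ (0 : E) ∈ U ∧ ∀ x ∈ U, φ x = 0) → u φ = 0) :
    ∃ N : ℕ, ∀ ψ : 𝓢(E, ℂ), (∀ j ≤ N, iteratedFDeriv ℝ j ψ 0 = 0) → u ψ = 0 := by
  obtain ⟨S, C, -, hS⟩ := Seminorm.bound_of_continuous (schwartz_withSeminorms ℂ E ℂ)
    ((normSeminorm ℂ ℂ).comp u.toLinearMap) (continuous_norm.comp u.continuous)
  refine ⟨S.sup Prod.snd, fun ψ hψ ↦ ?_⟩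
  let b : ContDiffBump (0 : E) := ⟨1, 2, one_pos, one_lt_two⟩
  have hb : HasCompactSupport fun x ↦ (b x : ℂ) := b.hasCompactSupport.comp_left Complex.ofReal_zero
  let χ : 𝓢(E, ℂ) := hb.toSchwartzMap (Complex.ofRealCLM.contDiff.comp b.contDiff)
  have hχb : ∀ x, χ x = b x := fun x ↦ rfl
  have hχ : tsupport χ ⊆ closedBall 0 2 := by
    refine closure_minimal (fun x hx ↦ ?_) isClosed_closedBall
    refine ball_subset_closedBall (?_ : x ∈ ball (0 : E) b.rOut)
    rw [← b.support_eq]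
    intro h
    exact hx (by rw [hχb, h, Complex.ofReal_zero])
  obtain ⟨K, hK, hbd⟩ := seminorm_dilation_smul_le hχ hψ
  have key : ∀ ε : ℝ, 0 < ε → ε ≤ 1 / 2 → ‖u ψ‖ ≤ C * K * ε := by
    intro ε h0 h1
    let s : ℝˣ := Units.mk0 ε h0.ne'
    have hdiff : u (ψ - smulLeftCLM ℂ (schwartzDilation s χ) ψ) = 0 := by
      refine hu _ ⟨ball 0 ε, isOpen_ball, mem_ball_self h0, fun x hx ↦ ?_⟩
      have hx1 : (s : ℝ)⁻¹ • x ∈ closedBall (0 : E) b.rIn := by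
        rw [mem_closedBall_zero_iff, norm_smul]
        change ‖ε⁻¹‖ * ‖x‖ ≤ 1
        rw [Real.norm_of_nonneg (inv_nonneg.2 h0.le), inv_mul_le_iff₀ h0, mul_one]
        exact (mem_ball_zero_iff.1 hx).le
      rw [sub_apply, smulLeftCLM_apply_apply (schwartzDilation s χ).hasTemperateGrowth,
        schwartzDilation_apply, hχb, b.one_of_mem_closedBall hx1]
      simp
    rw [map_sub, sub_eq_zero] at hdiff
    rw [hdiff]
    refine (hS _).trans ?_
    rw [mul_assoc]
    refine mul_le_mul_of_nonneg_left ?_ C.2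
    refine Seminorm.finset_sup_apply_le (by positivity) fun i hi ↦ ?_
    exact hbd s h0 h1 i.1 i.2 (Finset.le_sup (f := Prod.snd) hi)
  rw [← norm_le_zero_iff]
  have hlim : Filter.Tendsto (fun ε : ℝ ↦ C * K * ε) (nhdsWithin 0 (Set.Ioi 0)) (nhds 0) := by
    have : Continuous fun ε : ℝ ↦ C * K * ε := by fun_prop
    simpa using (this.tendsto 0).mono_left nhdsWithin_le_nhds
  refine ge_of_tendsto hlim ?_
  filter_upwards [Ioc_mem_nhdsGT (show (0 : ℝ) < 1 / 2 by norm_num)] with ε hε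
  exact key ε hε.1 hε.2

/-- The product of the operators `schwartzDilation (t k) - (t k) ^ (-k)` for `k < m`, which kills
the Taylor coefficients of order less than `m` at the origin. -/
noncomputable def taylorKiller (t : ℕ → ℝˣ) : ℕ → 𝓢(E, ℂ) →L[ℂ] 𝓢(E, ℂ)
  | 0 => ContinuousLinearMap.id ℂ _
  | m + 1 => (taylorKiller t m).comp
      (schwartzDilation (t m) - (((t m : ℝ)⁻¹ ^ m : ℝ) : ℂ) • ContinuousLinearMap.id ℂ _)

theorem taylorKiller_succ_apply (t : ℕ → ℝˣ) (m : ℕ) (φ : 𝓢(E, ℂ)) :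
    taylorKiller t (m + 1) φ =
      taylorKiller t m (schwartzDilation (t m) φ - (((t m : ℝ)⁻¹ ^ m : ℝ) : ℂ) • φ) := rfl

theorem iteratedFDeriv_taylorKiller_zero (t : ℕ → ℝˣ) (m j : ℕ) (φ : 𝓢(E, ℂ))
    (h : j < m ∨ iteratedFDeriv ℝ j φ 0 = 0) :
    iteratedFDeriv ℝ j (taylorKiller t m φ) 0 = 0 := by
  induction m generalizing φ with
  | zero => simpa [taylorKiller] using h
  | succ m ih =>
    rw [taylorKiller_succ_apply]
    refine ih _ ?_
    have e : iteratedFDeriv ℝ j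
        (schwartzDilation (t m) φ - (((t m : ℝ)⁻¹ ^ m : ℝ) : ℂ) • φ : 𝓢(E, ℂ)) 0 =
        ((t m : ℝ)⁻¹ ^ j - (t m : ℝ)⁻¹ ^ m) • iteratedFDeriv ℝ j φ 0 := by
      have hcoe : ((schwartzDilation (t m) φ - (((t m : ℝ)⁻¹ ^ m : ℝ) : ℂ) • φ : 𝓢(E, ℂ)) : E → ℂ) =
          (schwartzDilation (t m) φ : E → ℂ) - ((t m : ℝ)⁻¹ ^ m : ℝ) • (φ : E → ℂ) := by
        ext x
        simp
      have hsmul : ContDiff ℝ j (((t m : ℝ)⁻¹ ^ m : ℝ) • (φ : E → ℂ)) :=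
        contDiff_const.smul (φ.smooth j)
      rw [hcoe, iteratedFDeriv_sub_apply ((schwartzDilation (t m) φ).smooth j).contDiffAt
        hsmul.contDiffAt,
        iteratedFDeriv_const_smul_apply (φ.smooth j).contDiffAt, iteratedFDeriv_schwartzDilation,
        smul_zero, sub_smul]
    rcases h with h | h
    · rcases Nat.lt_succ_iff_lt_or_eq.1 h with h | rfl
      · exact .inl h
      · exact .inr (by rw [e, sub_self, zero_smul])
    · exact .inr (by rw [e, h, smul_zero])

/-- Weak homogeneity of degree `a` of a linear functional on Schwartz space. -/
def IsWeaklyHomogeneous (a : ℝ) (v : 𝓢(E, ℂ) →L[ℂ] ℂ) : Prop :=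
  ∀ φ, ∃ C : ℝ, ∀ s : ℝˣ, 0 < (s : ℝ) → ‖v (schwartzDilation s φ)‖ ≤ C * (s : ℝ) ^ a

theorem schwartzDilation_comm (s t : ℝˣ) (φ : 𝓢(E, ℂ)) :
    schwartzDilation s (schwartzDilation t φ) = schwartzDilation t (schwartzDilation s φ) := by
  ext x
  simp only [schwartzDilation_apply, smul_smul, mul_comm]

theorem IsWeaklyHomogeneous.comp_taylorKiller {a : ℝ} {u : 𝓢(E, ℂ) →L[ℂ] ℂ}
    (hu : IsWeaklyHomogeneous a u) (t : ℕ → ℝˣ) (m : ℕ) :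
    IsWeaklyHomogeneous a (u.comp (taylorKiller t m)) := by
  induction m with
  | zero => exact hu
  | succ m ih =>
    intro φ
    obtain ⟨C₁, h₁⟩ := ih (schwartzDilation (t m) φ)
    obtain ⟨C₂, h₂⟩ := ih φ
    refine ⟨C₁ + |(t m : ℝ)⁻¹ ^ m| * C₂, fun s hs ↦ ?_⟩
    have h1 := h₁ s hs
    have h2 := h₂ s hs
    rw [ContinuousLinearMap.comp_apply] at h1 h2 ⊢
    rw [taylorKiller_succ_apply, map_sub, map_sub, map_smul, map_smul, schwartzDilation_comm]
    refine (norm_sub_le _ _).trans ?_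
    rw [norm_smul, Complex.norm_real, Real.norm_eq_abs, add_mul, mul_assoc]
    gcongr

theorem IsWeaklyHomogeneous.eq_zero_of_dilation_eq {a : ℝ} {v : 𝓢(E, ℂ) →L[ℂ] ℂ}
    (hv : IsWeaklyHomogeneous a v) {t : ℝˣ} (ht : 0 < (t : ℝ)) {k : ℕ}
    (hlt : (t : ℝ) ^ (a + k) < 1)
    (h : ∀ φ, v (schwartzDilation t φ) = (((t : ℝ)⁻¹ ^ k : ℝ) : ℂ) * v φ) : v = 0 := by
  ext φ
  obtain ⟨C, hC⟩ := hv φ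
  have hiter : ∀ m : ℕ, v (schwartzDilation (t ^ m) φ) = (((t : ℝ)⁻¹ ^ k : ℝ) : ℂ) ^ m * v φ := by
    intro m
    induction m with
    | zero =>
      have : schwartzDilation (1 : ℝˣ) φ = φ := by
        ext x
        simp [schwartzDilation_apply]
      simp [this]
    | succ m ih =>
      have : schwartzDilation (t ^ (m + 1)) φ = schwartzDilation t (schwartzDilation (t ^ m) φ) := by
        ext x
        simp only [schwartzDilation_apply, smul_smul, pow_succ, Units.val_mul, mul_inv]
      rw [this, h, ih]
      ring
  have hbd : ∀ m : ℕ, ‖v φ‖ ≤ C * ((t : ℝ) ^ (a + k)) ^ m := by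
    intro m
    have := hC (t ^ m) (by simpa using pow_pos ht m)
    rw [hiter, norm_mul, norm_pow, Complex.norm_real, Real.norm_of_nonneg (by positivity),
      Units.val_pow_eq_pow_val, inv_pow, inv_pow, inv_mul_le_iff₀ (by positivity)] at this
    refine this.trans_eq ?_
    rw [Real.rpow_add ht, Real.rpow_natCast, mul_pow, ← Real.rpow_natCast ((t : ℝ) ^ a),
      ← Real.rpow_natCast (t : ℝ) m, ← Real.rpow_mul ht.le, ← Real.rpow_mul ht.le, mul_comm a]
    ring
  have hlim := (tendsto_pow_atTop_nhds_zero_of_lt_one (by positivity) hlt).const_mul C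
  rw [mul_zero] at hlim
  exact norm_le_zero_iff.1 (ge_of_tendsto' hlim hbd)

theorem exists_unit_rpow_lt_one {b : ℝ} (hb : b ≠ 0) : ∃ t : ℝˣ, 0 < (t : ℝ) ∧ (t : ℝ) ^ b < 1 := by
  rcases hb.lt_or_gt with hb | hb
  · exact ⟨Units.mk0 2 two_ne_zero, two_pos, Real.rpow_lt_one_of_one_lt_of_neg one_lt_two hb⟩
  · exact ⟨Units.mk0 (1 / 2) (by norm_num), by norm_num,
      Real.rpow_lt_one (by norm_num) (by norm_num) hb⟩

theorem IsWeaklyHomogeneous.eq_zero_of_support_zero [FiniteDimensional ℝ E] {a : ℝ}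
    (ha : ∀ k : ℕ, a ≠ -(k : ℝ)) {u : 𝓢(E, ℂ) →L[ℂ] ℂ}
    (hu : ∀ φ : 𝓢(E, ℂ), (∃ U : Set E, IsOpen U ∧ (0 : E) ∈ U ∧ ∀ x ∈ U, φ x = 0) → u φ = 0)
    (hweak : IsWeaklyHomogeneous a u) : u = 0 := by
  have hak : ∀ k : ℕ, a + k ≠ 0 := fun k h ↦ ha k (by linarith)
  choose t ht hlt using fun k ↦ exists_unit_rpow_lt_one (hak k)
  obtain ⟨N, hN⟩ := exists_order_of_support_zero u hu
  have hdesc : ∀ m, u.comp (taylorKiller t m) = 0 → u = 0 := by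
    intro m
    induction m with
    | zero => exact id
    | succ m ih =>
      intro h
      refine ih ((hweak.comp_taylorKiller t m).eq_zero_of_dilation_eq (ht m) (hlt m) fun φ ↦ ?_)
      have := congrArg (fun v : 𝓢(E, ℂ) →L[ℂ] ℂ ↦ v φ) h
      simp only [ContinuousLinearMap.comp_apply, taylorKiller_succ_apply, map_sub, map_smul,
        zero_apply, sub_eq_zero, smul_eq_mul] at this
      exact this
  refine hdesc (N + 1) (ContinuousLinearMap.ext fun φ ↦ hN _ fun j hj ↦ ?_)
  exact iteratedFDeriv_taylorKiller_zero t (N + 1) j φ (.inl (by omega))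

end Schwartz


/-- A tempered distribution on `ℝ^n` which is supported at the origin and weakly
homogeneous of degree `a ∈ ℝ`, with `−a ∉ ℕ`, is zero. -/
theorem stmt_14 (n : ℕ) (a : ℝ) (ha : ∀ k : ℕ, a ≠ -(k : ℝ))
    (u : SchwartzMap (Fin n → ℝ) ℂ →L[ℂ] ℂ)
    (hsupp : ∀ φ : SchwartzMap (Fin n → ℝ) ℂ,
      (∃ U : Set (Fin n → ℝ), IsOpen U ∧ (0 : Fin n → ℝ) ∈ U ∧ ∀ x ∈ U, φ x = 0) →
      u φ = 0)
    (hweak : ∀ φ : SchwartzMap (Fin n → ℝ) ℂ, ∃ C : ℝ, 0 < C ∧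
      ∀ s : ℝ, 0 < s → ∀ φs : SchwartzMap (Fin n → ℝ) ℂ,
        (∀ x, φs x = φ (s⁻¹ • x)) → ‖u φs‖ ≤ C * s ^ a) :
    u = 0 := by
  refine IsWeaklyHomogeneous.eq_zero_of_support_zero ha hsupp fun φ ↦ ?_
  obtain ⟨C, -, hC⟩ := hweak φ
  exact ⟨C, fun s hs ↦ hC s hs _ (schwartzDilation_apply s φ)⟩
end

section
/- Let a ∈ ℂ with −a ∉ ℕ (a is not a nonpositive integer). Let u be a tempered distribution on ℝ^n such that: (i) u(φ) = 0 for every Schwartz function φ that vanishes on some open neighborhood of the origin; (ii) u is homogeneous of degree a for the dilation action, i.e. for every s > 0 and all Schwartz Φ, Ψ with Ψ(x) = Φ(s⁻¹x) for all x, one has u(Ψ) = s^a·u(Φ), where s^a = exp(a·log s). Then u = 0. -/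
open scoped ContDiff Topology SchwartzMap
open MeasureTheory

universe w

section Hadamard

variable {E : Type w} [NormedAddCommGroup E] [NormedSpace ℝ E] [ProperSpace E]

theorem hasFDerivAt_intervalIntegral_of_contDiff {G : Type w} [NormedAddCommGroup G]
    [NormedSpace ℝ G] {F : E × ℝ → G} (hF : ContDiff ℝ 1 F) (a b : ℝ) (x : E) :
    HasFDerivAt (fun y => ∫ t in a..b, F (y, t))
      (∫ t in a..b, (fderiv ℝ F (x, t)).comp (ContinuousLinearMap.inl ℝ E ℝ)) x := by
  have hF' : Continuous fun p : E × ℝ =>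
      (fderiv ℝ F p).comp (ContinuousLinearMap.inl ℝ E ℝ) :=
    (hF.continuous_fderiv one_ne_zero).clm_comp continuous_const
  obtain ⟨C, hC⟩ := ((isCompact_closedBall x 1).prod
    (isCompact_uIcc (a := a) (b := b))).exists_bound_of_continuousOn hF'.continuousOn
  refine intervalIntegral.hasFDerivAt_integral_of_dominated_of_fderiv_le
    (F := fun y t => F (y, t))
    (F' := fun y t => (fderiv ℝ F (y, t)).comp (ContinuousLinearMap.inl ℝ E ℝ))
    (bound := fun _ => C) (Metric.closedBall_mem_nhds x one_pos) ?_ ?_ ?_ ?_ ?_ ?_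
  · exact .of_forall fun y =>
      (hF.continuous.comp (Continuous.prodMk_right y)).aestronglyMeasurable
  · exact (hF.continuous.comp (Continuous.prodMk_right x)).intervalIntegrable _ _
  · exact (hF'.comp (Continuous.prodMk_right x)).aestronglyMeasurable
  · exact .of_forall fun t ht y hy => hC (y, t) ⟨hy, Set.uIoc_subset_uIcc ht⟩
  · exact intervalIntegrable_const
  · exact .of_forall fun t _ y _ =>
      ((hF.differentiable one_ne_zero) (y, t)).hasFDerivAt.comp y (hasFDerivAt_prodMk_left y t)

theorem ContDiff.intervalIntegral_right {G : Type w} [NormedAddCommGroup G] [NormedSpace ℝ G]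
    {F : E × ℝ → G} {m : ℕ} (hF : ContDiff ℝ m F) (a b : ℝ) :
    ContDiff ℝ m fun x => ∫ t in a..b, F (x, t) := by
  induction m generalizing G with
  | zero =>
    rw [Nat.cast_zero, contDiff_zero] at hF ⊢
    exact intervalIntegral.continuous_parametric_intervalIntegral_of_continuous'
      (f := fun x t => F (x, t)) hF a b
  | succ m ih =>
    rw [Nat.cast_succ] at hF ⊢
    refine contDiff_succ_iff_hasFDerivAt.2 ⟨_, ih (F := fun p =>
      (fderiv ℝ F p).comp (ContinuousLinearMap.inl ℝ E ℝ)) ?_,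
      hasFDerivAt_intervalIntegral_of_contDiff (hF.of_le le_add_self) a b⟩
    exact (hF.fderiv_right le_rfl).clm_comp contDiff_const

end Hadamard

/-- The Hadamard lemma: a smooth function vanishing at the origin is divisible by the coordinates. -/
theorem ContDiff.exists_eq_clm_apply {E : Type} [NormedAddCommGroup E] [NormedSpace ℝ E]
    [ProperSpace E] {f : E → ℂ} (hf : ContDiff ℝ ∞ f) (h0 : f 0 = 0) :
    ∃ g : E → E →L[ℝ] ℂ, ContDiff ℝ ∞ g ∧ ∀ x, f x = g x x := by
  have hf' : ContDiff ℝ ∞ (fderiv ℝ f) := hf.fderiv_right (by simp)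
  refine ⟨fun x => ∫ t in (0 : ℝ)..1, fderiv ℝ f (t • x), ?_, fun x => ?_⟩
  · refine contDiff_infty.2 fun m => ContDiff.intervalIntegral_right
      (F := fun p : E × ℝ => fderiv ℝ f (p.2 • p.1)) ?_ 0 1
    exact (hf'.comp (contDiff_snd.smul contDiff_fst)).of_le (mod_cast le_top)
  · have hc : Continuous fun t : ℝ => fderiv ℝ f (t • x) := hf'.continuous.comp (by fun_prop)
    rw [ContinuousLinearMap.intervalIntegral_apply (hc.intervalIntegrable 0 1)]
    have hd : ∀ t ∈ Set.uIcc (0 : ℝ) 1,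
        HasDerivAt (fun t : ℝ => f (t • x)) (fderiv ℝ f (t • x) x) t := fun t _ => by
      have h := (hasDerivAt_id t).smul_const x
      rw [one_smul] at h
      exact ((hf.differentiable (by simp)) (t • x)).hasFDerivAt.comp_hasDerivAt t h
    rw [intervalIntegral.integral_eq_sub_of_hasDerivAt hd
      ((hc.clm_apply continuous_const).intervalIntegrable 0 1)]
    simp [h0]

section Support

variable {E : Type*} [NormedAddCommGroup E] [NormedSpace ℝ E]

/-- A tempered distribution which kills every Schwartz function vanishing near the origin. -/
def SupportedAtOrigin (u : 𝓢(E, ℂ) →L[ℂ] ℂ) : Prop :=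
  ∀ φ : 𝓢(E, ℂ), (∃ U : Set E, IsOpen U ∧ (0 : E) ∈ U ∧ ∀ x ∈ U, φ x = 0) → u φ = 0

/-- A tempered distribution which is homogeneous of degree `a` for the dilation action. -/
def HomogeneousOfDegree (u : 𝓢(E, ℂ) →L[ℂ] ℂ) (a : ℂ) : Prop :=
  ∀ s : ℝ, 0 < s → ∀ Φ Ψ : 𝓢(E, ℂ), (∀ x, Ψ x = Φ (s⁻¹ • x)) → u Ψ = (s : ℂ) ^ a * u Φ

variable {u : 𝓢(E, ℂ) →L[ℂ] ℂ} {a : ℂ}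

theorem SupportedAtOrigin.congr (hu : SupportedAtOrigin u) {φ ψ : 𝓢(E, ℂ)}
    (h : φ =ᶠ[𝓝 0] ψ) : u φ = u ψ := by
  obtain ⟨U, hU, hUo, h0⟩ := eventually_nhds_iff.1 h
  rw [← sub_eq_zero, ← map_sub]
  exact hu _ ⟨U, hUo, h0, fun x hx => by simp [hU x hx]⟩

theorem SchwartzMap.exists_dilation (Φ : 𝓢(E, ℂ)) {s : ℝ} (hs : s ≠ 0) :
    ∃ Ψ : 𝓢(E, ℂ), ∀ x, Ψ x = Φ (s • x) :=
  ⟨SchwartzMap.compCLMOfContinuousLinearEquiv ℂ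
    (ContinuousLinearEquiv.smulLeft (R₁ := ℝ) (M₁ := E) (Units.mk0 s hs)) Φ, fun _ => rfl⟩

theorem SchwartzMap.exists_eventuallyEq_one [FiniteDimensional ℝ E] :
    ∃ χ : 𝓢(E, ℂ), HasCompactSupport χ ∧ χ =ᶠ[𝓝 0] 1 := by
  let f : ContDiffBump (0 : E) := default
  have hc : HasCompactSupport fun x => (f x : ℂ) := 
    f.hasCompactSupport.comp_left (g := Complex.ofReal) Complex.ofReal_zero
  have hd : ContDiff ℝ ∞ fun x => (f x : ℂ) := Complex.ofRealCLM.contDiff.comp f.contDiff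
  refine ⟨hc.toSchwartzMap hd, hc, ?_⟩
  filter_upwards [f.eventuallyEq_one] with x hx
  simp [hx]

theorem SchwartzMap.seminorm_mul_dilation_le (χ Φ Ψ : 𝓢(E, ℂ)) {s : ℝ} (hs : |s| ≤ 1)
    (hΨ : ∀ x, Ψ x = χ x * Φ (s • x)) (k l : ℕ) :
    SchwartzMap.seminorm ℂ k l Ψ ≤ ∑ i ∈ Finset.range (l + 1),
      (l.choose i : ℝ) * SchwartzMap.seminorm ℂ k i χ * SchwartzMap.seminorm ℂ 0 (l - i) Φ := by
  refine SchwartzMap.seminorm_le_bound ℂ k l Ψ (by positivity) fun x => ?_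
  have hΦ : ContDiff ℝ ∞ fun x => Φ (s • x) := (Φ.smooth ⊤).comp (contDiff_const_smul s)
  have h := norm_iteratedFDeriv_mul_le (χ.smooth ⊤) hΦ x (n := l) (mod_cast le_top)
  rw [← funext hΨ] at h
  refine (mul_le_mul_of_nonneg_left h (by positivity)).trans ?_
  rw [Finset.mul_sum]
  refine Finset.sum_le_sum fun i _ => ?_
  have h1 := SchwartzMap.le_seminorm ℂ k i χ x
  have h2 : ‖iteratedFDeriv ℝ (l - i) (fun x => Φ (s • x)) x‖ ≤
      SchwartzMap.seminorm ℂ 0 (l - i) Φ := by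
    rw [iteratedFDeriv_comp_const_smul s (Φ.smooth (l - i : ℕ)), norm_smul, norm_pow,
      Real.norm_eq_abs]
    exact (mul_le_of_le_one_left (norm_nonneg _) (pow_le_one₀ (abs_nonneg s) hs)).trans
      (SchwartzMap.norm_iteratedFDeriv_le_seminorm ℂ Φ _ _)
  calc ‖x‖ ^ k * ((l.choose i : ℝ) * ‖iteratedFDeriv ℝ i χ x‖ *
        ‖iteratedFDeriv ℝ (l - i) (fun x => Φ (s • x)) x‖)
      = (l.choose i : ℝ) * (‖x‖ ^ k * ‖iteratedFDeriv ℝ i χ x‖) *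
        ‖iteratedFDeriv ℝ (l - i) (fun x => Φ (s • x)) x‖ := by ring
    _ ≤ _ := by gcongr

theorem SchwartzMap.exists_bound (u : 𝓢(E, ℂ) →L[ℂ] ℂ) {ι : Type*} (f : ι → 𝓢(E, ℂ))
    (B : ℕ → ℕ → ℝ) (hB : ∀ k l i, SchwartzMap.seminorm ℂ k l (f i) ≤ B k l) :
    ∃ C, ∀ i, ‖u (f i)‖ ≤ C := by
  obtain ⟨s, C, -, h⟩ := Seminorm.bound_of_continuous (schwartz_withSeminorms ℂ E ℂ)
    ((normSeminorm ℂ ℂ).comp u.toLinearMap) (continuous_norm.comp u.continuous)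
  refine ⟨C * ∑ p ∈ s, |B p.1 p.2|, fun i => (h (f i)).trans ?_⟩
  refine mul_le_mul_of_nonneg_left (Seminorm.finset_sup_apply_le (by positivity) ?_) C.2
  exact fun p hp => ((hB p.1 p.2 i).trans (le_abs_self _)).trans
    (Finset.single_le_sum (f := fun p : ℕ × ℕ => |B p.1 p.2|) (fun _ _ => abs_nonneg _) hp)

theorem SupportedAtOrigin.eq_zero_of_re_pos [FiniteDimensional ℝ E] (hu : SupportedAtOrigin u)
    (hh : HomogeneousOfDegree u a) (ha : 0 < a.re) : u = 0 := by
  ext Φ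
  obtain ⟨χ, -, hχ⟩ := SchwartzMap.exists_eventuallyEq_one (E := E)
  have hinv : ∀ s : Set.Ici (1 : ℝ), (s : ℝ)⁻¹ ≠ 0 := fun s =>
    inv_ne_zero (zero_lt_one.trans_le s.2).ne'
  choose Ψ hΨ using fun s : Set.Ici (1 : ℝ) => Φ.exists_dilation (hinv s)
  have hmul : ∀ s x, SchwartzMap.smulLeftCLM ℂ χ (Ψ s) x = χ x * Φ ((s : ℝ)⁻¹ • x) :=
    fun s x => by
      rw [SchwartzMap.smulLeftCLM_apply_apply χ.hasTemperateGrowth, hΨ, smul_eq_mul]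
  obtain ⟨C, hC⟩ := SchwartzMap.exists_bound u (fun s => SchwartzMap.smulLeftCLM ℂ χ (Ψ s)) _
    fun k l s => SchwartzMap.seminorm_mul_dilation_le χ Φ _
      (by rw [abs_of_nonneg (inv_nonneg.2 (zero_le_one.trans s.2))]; exact inv_le_one_of_one_le₀ s.2)
      (hmul s) k l
  have hb : ∀ s : ℝ, 1 ≤ s → s ^ a.re * ‖u Φ‖ ≤ C := fun s hs => by
    have hs0 : 0 < s := zero_lt_one.trans_le hs
    have h1 := hC ⟨s, hs⟩
    rw [hu.congr (ψ := Ψ ⟨s, hs⟩), hh s hs0 Φ _ (hΨ _), norm_mul,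
      Complex.norm_cpow_eq_rpow_re_of_pos hs0] at h1
    · exact h1
    · filter_upwards [hχ] with x hx
      simp [hmul, hΨ, hx]
  by_contra hne
  have hpos : 0 < ‖u Φ‖ := norm_pos_iff.2 hne
  have ht := ((tendsto_rpow_atTop ha).atTop_mul_const hpos).eventually_gt_atTop C
  obtain ⟨s, hs1, hs2⟩ := (ht.and (Filter.eventually_ge_atTop 1)).exists
  exact (hb s hs2).not_gt hs1

theorem HomogeneousOfDegree.comp_smulLeftCLM (hh : HomogeneousOfDegree u a) (L : E →L[ℝ] ℂ) :
    HomogeneousOfDegree (u ∘L SchwartzMap.smulLeftCLM ℂ L) (a + 1) := by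
  intro s hs Φ Ψ h
  have hs' : (s : ℂ) ≠ 0 := mod_cast hs.ne'
  have key := hh s hs ((s : ℂ) • SchwartzMap.smulLeftCLM ℂ L Φ) (SchwartzMap.smulLeftCLM ℂ L Ψ)
    fun x => by
      simp only [smul_apply, SchwartzMap.smulLeftCLM_apply_apply L.hasTemperateGrowth,
        h, map_smul, smul_eq_mul, Complex.real_smul, Complex.ofReal_inv]
      field_simp
  simp only [ContinuousLinearMap.comp_apply, key, map_smul, smul_eq_mul,
    Complex.cpow_add _ _ hs', Complex.cpow_one]
  ring

theorem SupportedAtOrigin.comp_smulLeftCLM (hu : SupportedAtOrigin u) (L : E →L[ℝ] ℂ) :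
    SupportedAtOrigin (u ∘L SchwartzMap.smulLeftCLM ℂ L) := by
  rintro φ ⟨U, hU, h0, h⟩
  exact hu _ ⟨U, hU, h0, fun x hx => by
    simp [SchwartzMap.smulLeftCLM_apply_apply L.hasTemperateGrowth, h x hx]⟩

end Support

/-- If all coordinate multiples of a distribution supported at the origin vanish, then the
distribution only depends on the value at the origin. -/
theorem SupportedAtOrigin.apply_eq_zero {ι : Type} [Fintype ι] {u : 𝓢(ι → ℝ, ℂ) →L[ℂ] ℂ}
    (hu : SupportedAtOrigin u)
    (hmul : ∀ L : (ι → ℝ) →L[ℝ] ℂ, u ∘L SchwartzMap.smulLeftCLM ℂ L = 0)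
    {Φ : 𝓢(ι → ℝ, ℂ)} (h0 : Φ 0 = 0) : u Φ = 0 := by
  classical
  obtain ⟨χ, hχc, hχ⟩ := SchwartzMap.exists_eventuallyEq_one (E := ι → ℝ)
  obtain ⟨g, hg, hΦ⟩ := (Φ.smooth ⊤).exists_eq_clm_apply h0
  let L (i : ι) : (ι → ℝ) →L[ℝ] ℂ := Complex.ofRealCLM ∘L ContinuousLinearMap.proj i
  have hc (i : ι) : HasCompactSupport fun x => χ x * g x (Pi.single i 1) := hχc.mul_right
  have hd (i : ι) : ContDiff ℝ ∞ fun x => χ x * g x (Pi.single i 1) :=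
    (χ.smooth ⊤).mul (hg.clm_apply contDiff_const)
  let ψ (i : ι) : 𝓢(ι → ℝ, ℂ) := (hc i).toSchwartzMap (hd i)
  have hψ (i : ι) : u (SchwartzMap.smulLeftCLM ℂ (L i) (ψ i)) = 0 :=
    DFunLike.congr_fun (hmul (L i)) (ψ i)
  rw [hu.congr (ψ := ∑ i, SchwartzMap.smulLeftCLM ℂ (L i) (ψ i)), map_sum]
  · exact Finset.sum_eq_zero fun i _ => hψ i
  · filter_upwards [hχ] with x hx
    rw [sum_apply, hΦ]
    refine (congrArg (g x) (pi_eq_sum_univ' x)).trans ((map_sum _ _ _).trans ?_)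
    refine Finset.sum_congr rfl fun i _ => ?_
    rw [SchwartzMap.smulLeftCLM_apply_apply (L i).hasTemperateGrowth]
    simp [ψ, L, hx]

theorem exists_cpow_ne_one {a : ℂ} (ha : a ≠ 0) : ∃ s : ℝ, 0 < s ∧ (s : ℂ) ^ a ≠ 1 := by
  refine ⟨Real.exp ‖a‖⁻¹, Real.exp_pos _, fun h => ?_⟩
  rw [Complex.cpow_def_of_ne_zero (mod_cast (Real.exp_pos _).ne'), ← Complex.ofReal_log
    (Real.exp_pos _).le, Real.log_exp, Complex.exp_eq_one_iff] at h
  obtain ⟨m, hm⟩ := h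
  have h1 := congrArg norm hm
  rw [norm_mul, Complex.norm_real, norm_inv, norm_norm, inv_mul_cancel₀ (norm_ne_zero_iff.2 ha)]
    at h1
  have h2 : (1 : ℝ) = |(m : ℝ)| * (2 * Real.pi) := by
    simpa [abs_of_pos Real.pi_pos] using h1
  rcases eq_or_ne m 0 with rfl | hm0
  · simp at h2
  · have h3 : (1 : ℝ) ≤ |(m : ℝ)| := mod_cast Int.one_le_abs hm0
    nlinarith [Real.pi_gt_three]

theorem SupportedAtOrigin.eq_zero_of_homogeneous {ι : Type} [Fintype ι] (k : ℕ) {a : ℂ}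
    {u : 𝓢(ι → ℝ, ℂ) →L[ℂ] ℂ} (hu : SupportedAtOrigin u) (hh : HomogeneousOfDegree u a)
    (ha : ∀ m : ℕ, a ≠ -(m : ℂ)) (hk : -(k : ℝ) < a.re) : u = 0 := by
  induction k generalizing a u with
  | zero => exact hu.eq_zero_of_re_pos hh (by simpa using hk)
  | succ k ih =>
    have hmul (L : (ι → ℝ) →L[ℝ] ℂ) : u ∘L SchwartzMap.smulLeftCLM ℂ L = 0 := by
      refine ih (hu.comp_smulLeftCLM L) (hh.comp_smulLeftCLM L) (fun m hm => ha (m + 1) ?_) ?_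
      · rw [eq_sub_of_add_eq hm]; push_cast; ring
      · push_cast at hk; simp; linarith
    obtain ⟨s, hs, hsa⟩ := exists_cpow_ne_one (a := a) (by simpa using ha 0)
    ext Φ
    obtain ⟨Ψ, hΨ⟩ := Φ.exists_dilation (inv_ne_zero hs.ne')
    have h1 := hu.apply_eq_zero hmul (Φ := Ψ - Φ) (by simp [hΨ])
    rw [map_sub, hh s hs Φ Ψ hΨ, ← sub_one_mul] at h1
    exact (mul_eq_zero.1 h1).resolve_left (sub_ne_zero.2 hsa)

/-- A tempered distribution on `ℝ^n` which is supported at the origin and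
homogeneous of degree `a ∈ ℂ` for the dilation action, with `−a ∉ ℕ`, is zero. -/
theorem stmt_15 (n : ℕ) (a : ℂ) (ha : ∀ k : ℕ, a ≠ -(k : ℂ))
    (u : SchwartzMap (Fin n → ℝ) ℂ →L[ℂ] ℂ)
    (hsupp : ∀ φ : SchwartzMap (Fin n → ℝ) ℂ,
      (∃ U : Set (Fin n → ℝ), IsOpen U ∧ (0 : Fin n → ℝ) ∈ U ∧ ∀ x ∈ U, φ x = 0) →
      u φ = 0)
    (hhom : ∀ s : ℝ, 0 < s → ∀ Φ Ψ : SchwartzMap (Fin n → ℝ) ℂ,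
      (∀ x, Ψ x = Φ (s⁻¹ • x)) → u Ψ = (s : ℂ) ^ a * u Φ) :
    u = 0 := by
  obtain ⟨k, hk⟩ := exists_nat_gt (-a.re)
  exact SupportedAtOrigin.eq_zero_of_homogeneous k hsupp hhom ha (neg_lt.1 hk)
end
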